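/- arXiv:physics/0206094 — 2 statements merged into one kernel-verified Lean document; each statement's English description precedes it below -/
import Mathlib

section
/- Let (ω,u) be a smooth solution of the vorticity form of the 2D incompressible Euler equations on ℍ with nonnegative, compactly supported initial vorticity ω₀ = ω(0,·). Then for every k ∈ ℕ there exist positive constants D₁ and D₂, depending only on ω₀ and k, such that ∫_{{y ∈ ℍ : y₁ < −r}} ω(t,y) dy ≤ D₁/r^k whenever t ≥ 2 and r ≥ D₂ (t log t)^{1/2}. -/
open MeasureTheory

/-- The Euclidean norm on `ℝ × ℝ`. -/
noncomputable def nrm (z : ℝ × ℝ) : ℝ := Real.sqrt (z.1 ^ 2 + z.2 ^ 2)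

/-- The upper half-plane `ℍ = {x ∈ ℝ² : x₂ > 0}`. -/
def Hplane : Set (ℝ × ℝ) := {x | 0 < x.2}

/-- Reflection `x̄ = (x₁, -x₂)`. -/
def pbar (z : ℝ × ℝ) : ℝ × ℝ := (z.1, -z.2)

/-- Perpendicular vector `z^⊥ = (-z₂, z₁)`. -/
def perp (z : ℝ × ℝ) : ℝ × ℝ := (-z.2, z.1)

/-- The half-plane Biot–Savart kernel
`K(x,y) = (x-y)^⊥/(2π|x-y|²) - (x-ȳ)^⊥/(2π|x-ȳ|²)`. -/
noncomputable def Kker (x y : ℝ × ℝ) : ℝ × ℝ :=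
  (2 * Real.pi * nrm (x - y) ^ 2)⁻¹ • perp (x - y) -
    (2 * Real.pi * nrm (x - pbar y) ^ 2)⁻¹ • perp (x - pbar y)

/-- A smooth solution of the vorticity form of the 2D incompressible Euler
equations on the half-plane `ℍ`: `ω` is smooth, compactly supported in `ℍ`
at each time, transported by the velocity `u` recovered from `ω` by the
half-plane Biot–Savart law. -/
structure IsEulerSol (ω : ℝ → ℝ × ℝ → ℝ) (u : ℝ → ℝ × ℝ → ℝ × ℝ) : Prop where
  smooth : ContDiff ℝ (⊤ : ℕ∞) (fun q : ℝ × (ℝ × ℝ) => ω q.1 q.2)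
  compactSupp : ∀ t, HasCompactSupport (ω t)
  suppIn : ∀ t, tsupport (ω t) ⊆ Hplane
  biotSavart : ∀ t x, u t x = ∫ y in Hplane, ω t y • Kker x y
  transport : ∀ t, 0 ≤ t → ∀ x ∈ Hplane,
    deriv (fun s => ω s x) t + fderiv ℝ (ω t) x (u t x) = 0

namespace HalfPlaneEuler

open Set Filter Topology

/-- The whole-plane Biot–Savart kernel. -/
noncomputable def planeKer (z : ℝ × ℝ) : ℝ × ℝ :=
  (2 * Real.pi * nrm z ^ 2)⁻¹ • perp z

lemma nrm_sq (z : ℝ × ℝ) : nrm z ^ 2 = z.1 ^ 2 + z.2 ^ 2 :=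
  Real.sq_sqrt (by positivity)

lemma planeKer_fst (z : ℝ × ℝ) :
    (planeKer z).1 = -(z.2 / (2 * Real.pi * (z.1 ^ 2 + z.2 ^ 2))) := by
  simp [planeKer, nrm_sq, perp, div_eq_inv_mul]

lemma planeKer_snd (z : ℝ × ℝ) :
    (planeKer z).2 = z.1 / (2 * Real.pi * (z.1 ^ 2 + z.2 ^ 2)) := by
  simp [planeKer, nrm_sq, perp, div_eq_inv_mul]

lemma measurable_planeKer : Measurable planeKer := by
  have : planeKer = fun z : ℝ × ℝ => (-(z.2 / (2 * Real.pi * (z.1 ^ 2 + z.2 ^ 2))),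
      z.1 / (2 * Real.pi * (z.1 ^ 2 + z.2 ^ 2))) := by
    funext z
    exact Prod.ext (planeKer_fst z) (planeKer_snd z)
  rw [this]
  fun_prop

lemma norm_planeKer_le (z : ℝ × ℝ) : ‖planeKer z‖ ≤ ‖z‖⁻¹ := by
  rcases eq_or_ne z 0 with rfl | hz
  · simp [planeKer, perp]
  have hz0 : 0 < ‖z‖ := norm_pos_iff.2 hz
  have h1 : |z.1| ≤ ‖z‖ := norm_fst_le z
  have h2 : |z.2| ≤ ‖z‖ := norm_snd_le z
  have hsq : ‖z‖ ^ 2 ≤ z.1 ^ 2 + z.2 ^ 2 := by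
    rw [Prod.norm_def, Real.norm_eq_abs, Real.norm_eq_abs]
    rcases max_cases |z.1| |z.2| with ⟨h, -⟩ | ⟨h, -⟩ <;> rw [h, sq_abs] <;> nlinarith
  have hpos : 0 < z.1 ^ 2 + z.2 ^ 2 := lt_of_lt_of_le (by positivity) hsq
  have hpi : 1 ≤ 2 * Real.pi := by linarith [Real.pi_gt_three]
  have key : ∀ a : ℝ, |a| ≤ ‖z‖ → |a / (2 * Real.pi * (z.1 ^ 2 + z.2 ^ 2))| ≤ ‖z‖⁻¹ := by
    intro a ha
    rw [abs_div, abs_of_pos (a := 2 * Real.pi * (z.1 ^ 2 + z.2 ^ 2)) (by positivity),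
      div_le_iff₀ (by positivity), inv_mul_eq_div, le_div_iff₀ hz0]
    nlinarith [mul_le_mul_of_nonneg_right ha hz0.le]
  rw [Prod.norm_def, planeKer_fst, planeKer_snd, norm_neg]
  exact max_le (key _ h2) (key _ h1)

/-- An integrable radial function which, together with powers of the vorticity,
dominates the Biot–Savart integrand. -/
noncomputable def radialBound (r : ℝ) : ℝ :=
  if r ≤ 1 then r ^ (-(3 / 2) : ℝ) else r ^ (-3 : ℝ)

lemma radialBound_nonneg {r : ℝ} (hr : 0 ≤ r) : 0 ≤ radialBound r := by
  unfold radialBound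
  split_ifs <;> positivity

lemma integrable_radialBound : Integrable fun z : ℝ × ℝ => radialBound ‖z‖ := by
  have h := (integrable_fun_norm_addHaar (μ := (volume : Measure (ℝ × ℝ)))
    (f := radialBound)).2 ?_
  · exact h
  have hd : Module.finrank ℝ (ℝ × ℝ) = 2 := by simp
  rw [hd, ← Ioc_union_Ioi_eq_Ioi (zero_le_one' ℝ)]
  refine IntegrableOn.union ?_ ?_
  · have : IntegrableOn (fun y : ℝ => y ^ (-(1 / 2) : ℝ)) (Ioc 0 1) := by
      rw [← intervalIntegrable_iff_integrableOn_Ioc_of_le zero_le_one]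
      exact intervalIntegral.intervalIntegrable_rpow' (by norm_num)
    refine this.congr_fun (fun y hy => ?_) measurableSet_Ioc
    have : (-(1 / 2) : ℝ) = 1 + -(3 / 2) := by norm_num
    simp only [radialBound, if_pos hy.2, smul_eq_mul]
    rw [this, Real.rpow_add hy.1, Real.rpow_one, pow_one]
  · have : IntegrableOn (fun y : ℝ => y ^ (-2 : ℝ)) (Ioi 1) :=
      integrableOn_Ioi_rpow_of_lt (by norm_num) one_pos
    refine this.congr_fun (fun y hy => ?_) measurableSet_Ioi
    have h2 : (-2 : ℝ) = 1 + -3 := by norm_num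
    have hy' : (1 : ℝ) < y := hy
    simp only [radialBound, if_neg (not_le.2 hy'), smul_eq_mul]
    rw [h2, Real.rpow_add (by linarith), Real.rpow_one, pow_one]

/-- The profile `|s|³ + |s|^{3/2}` whose spatial integral controls the velocity. -/
noncomputable def profile (s : ℝ) : ℝ := ‖s‖ ^ (3 : ℝ) + ‖s‖ ^ (3 / 2 : ℝ)

lemma profile_nonneg (s : ℝ) : 0 ≤ profile s := by unfold profile; positivity

lemma profile_zero : profile 0 = 0 := by simp [profile]

lemma contDiff_profile : ContDiff ℝ 1 profile :=
  (contDiff_norm_rpow (by norm_num)).add (contDiff_norm_rpow (by norm_num))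

lemma norm_mul_inv_le (s r : ℝ) (hr : 0 ≤ r) : ‖s‖ * r⁻¹ ≤ profile s + radialBound r := by
  rcases hr.eq_or_lt with rfl | hr
  · simpa using add_nonneg (profile_nonneg s) (radialBound_nonneg le_rfl)
  have hs := norm_nonneg s
  have hinv : r⁻¹ = r ^ (-1 : ℝ) := by rw [Real.rpow_neg_one]
  have hR := radialBound_nonneg hr.le
  have hP := profile_nonneg s
  unfold profile at *
  by_cases h1 : r ≤ 1
  · rcases le_total ‖s‖ (r ^ (-(1 / 2) : ℝ)) with h | h
    · have : ‖s‖ * r⁻¹ ≤ radialBound r := by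
        rw [radialBound, if_pos h1, show (-(3 / 2) : ℝ) = -(1 / 2) + -1 by norm_num,
          Real.rpow_add hr, ← hinv]
        gcongr
      linarith
    · have h2 : r⁻¹ ≤ ‖s‖ ^ (2 : ℝ) := by
        have := Real.rpow_le_rpow (by positivity) h (by norm_num : (0 : ℝ) ≤ 2)
        rw [← Real.rpow_mul hr.le] at this
        rw [hinv]
        convert this using 2
        norm_num
      have hs' : 0 < ‖s‖ := lt_of_lt_of_le (by positivity) h
      have : ‖s‖ * r⁻¹ ≤ ‖s‖ ^ (3 : ℝ) := by
        rw [show (3 : ℝ) = 1 + 2 by norm_num, Real.rpow_add hs', Real.rpow_one]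
        gcongr
      have : 0 ≤ ‖s‖ ^ (3 / 2 : ℝ) := by positivity
      linarith
  · rcases le_total ‖s‖ (r ^ (-2 : ℝ)) with h | h
    · have : ‖s‖ * r⁻¹ ≤ radialBound r := by
        rw [radialBound, if_neg h1, show (-3 : ℝ) = -2 + -1 by norm_num,
          Real.rpow_add hr, ← hinv]
        gcongr
      linarith
    · have h2 : r⁻¹ ≤ ‖s‖ ^ (1 / 2 : ℝ) := by
        have := Real.rpow_le_rpow (by positivity) h (by norm_num : (0 : ℝ) ≤ 1 / 2)
        rw [← Real.rpow_mul hr.le] at this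
        rw [hinv]
        convert this using 2
        norm_num
      have hs' : 0 < ‖s‖ := lt_of_lt_of_le (by positivity) h
      have : ‖s‖ * r⁻¹ ≤ ‖s‖ ^ (3 / 2 : ℝ) := by
        rw [show (3 / 2 : ℝ) = 1 + 1 / 2 by norm_num, Real.rpow_add hs', Real.rpow_one]
        gcongr
      have : 0 ≤ ‖s‖ ^ (3 : ℝ) := by positivity
      linarith

/-- The velocity field generated in the whole plane by the vorticity `f`. -/
noncomputable def planeVel (f : ℝ × ℝ → ℝ) (x : ℝ × ℝ) : ℝ × ℝ :=
  ∫ y, f y • planeKer (x - y)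

section planeVel

variable {f : ℝ × ℝ → ℝ}

lemma norm_smul_planeKer_le (f : ℝ × ℝ → ℝ) (x y : ℝ × ℝ) :
    ‖f y • planeKer (x - y)‖ ≤ profile (f y) + radialBound ‖x - y‖ := by
  rw [norm_smul]
  exact (mul_le_mul_of_nonneg_left (norm_planeKer_le _) (norm_nonneg _)).trans
    (norm_mul_inv_le _ _ (norm_nonneg _))

lemma integrable_profile_comp (hf : Continuous f) (hc : HasCompactSupport f) :
    Integrable fun y => profile (f y) :=
  (contDiff_profile.continuous.comp hf).integrable_of_hasCompactSupport
    (hc.comp_left profile_zero)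

lemma integrable_radialBound_sub (x : ℝ × ℝ) :
    Integrable fun y : ℝ × ℝ => radialBound ‖x - y‖ :=
  integrable_radialBound.comp_sub_left x

lemma integrable_smul_planeKer (hf : Continuous f) (hc : HasCompactSupport f) (x : ℝ × ℝ) :
    Integrable fun y => f y • planeKer (x - y) := by
  refine ((integrable_profile_comp hf hc).add (integrable_radialBound_sub x)).mono' ?_
    (.of_forall (norm_smul_planeKer_le f x))
  exact (hf.measurable.smul (measurable_planeKer.comp (by fun_prop))).aestronglyMeasurable

lemma norm_planeVel_le (hf : Continuous f) (hc : HasCompactSupport f) (x : ℝ × ℝ) :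
    ‖planeVel f x‖ ≤ (∫ y, profile (f y)) + ∫ z : ℝ × ℝ, radialBound ‖z‖ := by
  rw [← integral_sub_left_eq_self (fun z : ℝ × ℝ => radialBound ‖z‖) volume x,
    ← integral_add (integrable_profile_comp hf hc) (integrable_radialBound_sub x)]
  exact norm_integral_le_of_norm_le
    ((integrable_profile_comp hf hc).add (integrable_radialBound_sub x))
    (.of_forall (norm_smul_planeKer_le f x))

lemma measurable_smul_planeKer (hf : Continuous f) :
    Measurable fun p : (ℝ × ℝ) × (ℝ × ℝ) => f p.2 • planeKer (p.1 - p.2) :=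
  (hf.measurable.comp measurable_snd).smul (measurable_planeKer.comp (by fun_prop))

lemma stronglyMeasurable_planeVel (hf : Continuous f) : StronglyMeasurable (planeVel f) :=
  (measurable_smul_planeKer hf).stronglyMeasurable.integral_prod_right

lemma integral_fderiv_planeKer_eq_zero {ψ : ℝ × ℝ → ℝ} (hψ : ContDiff ℝ 1 ψ) :
    ∫ z, fderiv ℝ ψ z (planeKer z) = 0 := by
  rw [← integral_comp_polarCoord_symm]
  by_cases hi : IntegrableOn (fun p : ℝ × ℝ => p.1 • fderiv ℝ ψ (polarCoord.symm p)
      (planeKer (polarCoord.symm p))) polarCoord.target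
  swap
  · exact integral_undef hi
  rw [polarCoord_target, Measure.volume_eq_prod] at *
  rw [setIntegral_prod _ hi]
  refine setIntegral_eq_zero_of_forall_eq_zero fun r hr => ?_
  have hr : (0 : ℝ) < r := hr
  have hpi : -Real.pi ≤ Real.pi := by linarith [Real.pi_pos]
  rw [← integral_Ioc_eq_integral_Ioo, ← intervalIntegral.integral_of_le hpi]
  have hcurve : ∀ θ : ℝ, HasDerivAt (fun θ : ℝ => (r * Real.cos θ, r * Real.sin θ))
      (-(r * Real.sin θ), r * Real.cos θ) θ := fun θ => by
    refine HasDerivAt.prodMk ?_ ?_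
    · simpa using (Real.hasDerivAt_cos θ).const_mul r
    · exact (Real.hasDerivAt_sin θ).const_mul r
  have hder : ∀ θ : ℝ, HasDerivAt
      (fun θ : ℝ => (2 * Real.pi * r)⁻¹ * ψ (r * Real.cos θ, r * Real.sin θ))
      (r • fderiv ℝ ψ (polarCoord.symm (r, θ)) (planeKer (polarCoord.symm (r, θ)))) θ := by
    intro θ
    have h1 := ((hψ.differentiable one_ne_zero
      (r * Real.cos θ, r * Real.sin θ)).hasFDerivAt.comp_hasDerivAt θ (hcurve θ)).const_mul
      (2 * Real.pi * r)⁻¹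
    refine h1.congr_deriv ?_
    symm
    rw [← smul_eq_mul (2 * Real.pi * r)⁻¹, ← map_smul, ← map_smul, polarCoord_symm_apply]
    congr 1
    have hs : (r * Real.cos θ) ^ 2 + (r * Real.sin θ) ^ 2 = r ^ 2 := by
      linear_combination r ^ 2 * Real.sin_sq_add_cos_sq θ
    ext
    · simp only [Prod.smul_fst, planeKer_fst, hs, smul_eq_mul]
      field_simp
    · simp only [Prod.smul_snd, planeKer_snd, hs, smul_eq_mul]
      field_simp
  rw [intervalIntegral.integral_eq_sub_of_hasDerivAt (fun θ _ => hder θ)]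
  · simp
  · apply Continuous.intervalIntegrable
    have hK : ∀ θ, planeKer (polarCoord.symm (r, θ)) =
        (-(Real.sin θ / (2 * Real.pi * r)), Real.cos θ / (2 * Real.pi * r)) := by
      intro θ
      have hs : (r * Real.cos θ) ^ 2 + (r * Real.sin θ) ^ 2 = r ^ 2 := by
        linear_combination r ^ 2 * Real.sin_sq_add_cos_sq θ
      rw [polarCoord_symm_apply]
      ext
      · simp only [planeKer_fst, hs]
        field_simp
      · simp only [planeKer_snd, hs]
        field_simp
    simp only [hK]
    have := hψ.continuous_fderiv one_ne_zero
    have h2 : Continuous fun θ : ℝ => fderiv ℝ ψ (polarCoord.symm (r, θ)) :=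
      this.comp (continuous_polarCoord_symm.comp (by fun_prop))
    exact (h2.clm_apply (by fun_prop)).const_smul r

lemma integral_fderiv_planeVel_eq_zero (hf : Continuous f) (hc : HasCompactSupport f)
    {ψ : ℝ × ℝ → ℝ} (hψ : ContDiff ℝ 1 ψ) (hψc : HasCompactSupport ψ) :
    ∫ x, fderiv ℝ ψ x (planeVel f x) = 0 := by
  have hd : Continuous (fderiv ℝ ψ) := hψ.continuous_fderiv one_ne_zero
  have hint : Integrable (Function.uncurry fun x y : ℝ × ℝ =>
      fderiv ℝ ψ x (f y • planeKer (x - y))) (volume.prod volume) := by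
    have hnd : Integrable fun x => ‖fderiv ℝ ψ x‖ :=
      hd.norm.integrable_of_hasCompactSupport (hψc.fderiv ℝ).norm
    have b1 := hnd.mul_prod (integrable_profile_comp hf hc)
    have b2 := (hnd.convolution_integrand (ContinuousLinearMap.mul ℝ ℝ)
      integrable_radialBound).swap
    refine (b1.add b2).mono' ?_ (.of_forall fun p => ?_)
    · have h1 : StronglyMeasurable fun p : (ℝ × ℝ) × (ℝ × ℝ) => fderiv ℝ ψ p.1 :=
        (hd.comp continuous_fst).stronglyMeasurable
      exact isBoundedBilinearMap_apply.continuous.comp_aestronglyMeasurable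
        (h1.aestronglyMeasurable.prodMk (measurable_smul_planeKer hf).aestronglyMeasurable)
    · have h1 := (fderiv ℝ ψ p.1).le_opNorm (f p.2 • planeKer (p.1 - p.2))
      have h2 := mul_le_mul_of_nonneg_left (norm_smul_planeKer_le f p.1 p.2)
        (norm_nonneg (fderiv ℝ ψ p.1))
      have h3 : ‖p.2 - p.1‖ = ‖p.1 - p.2‖ := norm_sub_rev _ _
      simp only [Function.uncurry, Pi.add_apply, Function.comp_apply, Prod.fst_swap,
        Prod.snd_swap, ContinuousLinearMap.mul_apply', h3]
      linarith
  have h1 : ∀ x, fderiv ℝ ψ x (planeVel f x) = ∫ y, fderiv ℝ ψ x (f y • planeKer (x - y)) :=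
    fun x => ((fderiv ℝ ψ x).integral_comp_comm (integrable_smul_planeKer hf hc x)).symm
  simp_rw [h1]
  rw [integral_integral_swap hint]
  refine integral_eq_zero_of_ae (.of_forall fun y => ?_)
  simp only [map_smul, smul_eq_mul, Pi.zero_apply]
  rw [integral_const_mul]
  have h2 := integral_fderiv_planeKer_eq_zero
    (hψ.comp (contDiff_id.add (contDiff_const (c := y))))
  rw [← integral_sub_right_eq_self _ y] at h2
  simp only [Function.comp_def, id_eq] at h2
  have h3 : ∀ x, fderiv ℝ (fun z => ψ (z + y)) (x - y) = fderiv ℝ ψ x := fun x => by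
    rw [fderiv_comp_add_right, sub_add_cancel]
  simp only [h3] at h2
  rw [h2, mul_zero]

end planeVel

section reflection

lemma pbar_pbar (z : ℝ × ℝ) : pbar (pbar z) = z := by simp [pbar]

lemma continuous_pbar : Continuous pbar := by unfold pbar; fun_prop

/-- Reflection in the horizontal axis as a homeomorphism. -/
def pbarHomeomorph : (ℝ × ℝ) ≃ₜ (ℝ × ℝ) where
  toFun := pbar
  invFun := pbar
  left_inv := pbar_pbar
  right_inv := pbar_pbar
  continuous_toFun := continuous_pbar
  continuous_invFun := continuous_pbar

lemma integral_comp_pbar {E : Type*} [NormedAddCommGroup E] [NormedSpace ℝ E]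
    (f : ℝ × ℝ → E) : ∫ y, f (pbar y) = ∫ y, f y := by
  have h : MeasurePreserving pbar (volume : Measure (ℝ × ℝ)) volume :=
    (MeasurePreserving.id (volume : Measure ℝ)).prod (Measure.measurePreserving_neg volume)
  exact h.integral_comp pbarHomeomorph.measurableEmbedding f

end reflection

variable {ω : ℝ → ℝ × ℝ → ℝ} {u : ℝ → ℝ × ℝ → ℝ × ℝ}

section basic

variable (hsol : IsEulerSol ω u)
include hsol

lemma contDiff_uncurry : ContDiff ℝ 1 (fun q : ℝ × (ℝ × ℝ) => ω q.1 q.2) :=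
  hsol.smooth.of_le (by exact_mod_cast le_top)

lemma contDiff_slice (t : ℝ) : ContDiff ℝ 1 (ω t) :=
  (contDiff_uncurry hsol).comp (contDiff_const.prodMk contDiff_id)

lemma continuous_slice (t : ℝ) : Continuous (ω t) := (contDiff_slice hsol t).continuous

lemma hasCompactSupport_comp_pbar (t : ℝ) : HasCompactSupport fun y => ω t (pbar y) :=
  (hsol.compactSupp t).comp_homeomorph pbarHomeomorph

lemma continuous_comp_pbar (t : ℝ) : Continuous fun y => ω t (pbar y) :=
  (continuous_slice hsol t).comp continuous_pbar

lemma eq_zero_of_snd_nonpos (t : ℝ) {x : ℝ × ℝ} (hx : x.2 ≤ 0) : ω t x = 0 :=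
  image_eq_zero_of_notMem_tsupport fun h => not_lt.2 hx (hsol.suppIn t h)

lemma velocity_eq (t : ℝ) (x : ℝ × ℝ) :
    u t x = planeVel (ω t) x - planeVel (fun y => ω t (pbar y)) x := by
  rw [hsol.biotSavart, setIntegral_eq_integral_of_forall_compl_eq_zero]
  swap
  · intro y hy
    rw [eq_zero_of_snd_nonpos hsol t (not_lt.1 hy), zero_smul]
  have h2 : planeVel (fun y => ω t (pbar y)) x = ∫ y, ω t y • planeKer (x - pbar y) := by
    rw [planeVel, ← integral_comp_pbar]
    simp only [pbar_pbar]
  have h3 : Integrable fun y => ω t y • planeKer (x - pbar y) := by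
    have h4 := integrable_smul_planeKer (continuous_comp_pbar hsol t)
      (hasCompactSupport_comp_pbar hsol t) x
    have h : MeasurePreserving pbar (volume : Measure (ℝ × ℝ)) volume :=
      (MeasurePreserving.id (volume : Measure ℝ)).prod (Measure.measurePreserving_neg volume)
    have h5 := h.integrable_comp_of_integrable h4
    simpa only [Function.comp_def, pbar_pbar] using h5
  rw [h2, planeVel, ← integral_sub
    (integrable_smul_planeKer (continuous_slice hsol t) (hsol.compactSupp t) x) h3]
  refine integral_congr_ae (.of_forall fun y => ?_)
  simp only [Kker, planeKer, smul_sub]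

lemma norm_velocity_le (t : ℝ) (x : ℝ × ℝ) :
    ‖u t x‖ ≤ 2 * ((∫ y, profile (ω t y)) + ∫ z : ℝ × ℝ, radialBound ‖z‖) := by
  rw [velocity_eq hsol]
  have h1 := norm_planeVel_le (continuous_slice hsol t) (hsol.compactSupp t) x
  have h2 := norm_planeVel_le (continuous_comp_pbar hsol t) (hasCompactSupport_comp_pbar hsol t) x
  rw [integral_comp_pbar fun y => profile (ω t y)] at h2
  linarith [norm_sub_le (planeVel (ω t) x) (planeVel (fun y => ω t (pbar y)) x)]

lemma stronglyMeasurable_velocity (t : ℝ) : StronglyMeasurable (u t) := by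
  have : u t = fun x => planeVel (ω t) x - planeVel (fun y => ω t (pbar y)) x :=
    funext (velocity_eq hsol t)
  rw [this]
  exact (stronglyMeasurable_planeVel (continuous_slice hsol t)).sub
    (stronglyMeasurable_planeVel (continuous_comp_pbar hsol t))

lemma integrable_clm_velocity (t : ℝ) {L : ℝ × ℝ → (ℝ × ℝ →L[ℝ] ℝ)} (hL : Continuous L)
    (hc : HasCompactSupport L) : Integrable fun x => L x (u t x) := by
  refine ((hL.norm.integrable_of_hasCompactSupport hc.norm).mul_const
    (2 * ((∫ y, profile (ω t y)) + ∫ z : ℝ × ℝ, radialBound ‖z‖))).mono' ?_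
    (.of_forall fun x => ?_)
  · exact isBoundedBilinearMap_apply.continuous.comp_aestronglyMeasurable
      (hL.stronglyMeasurable.aestronglyMeasurable.prodMk
        (stronglyMeasurable_velocity hsol t).aestronglyMeasurable)
  · exact ((L x).le_opNorm _).trans
      (mul_le_mul_of_nonneg_left (norm_velocity_le hsol t x) (norm_nonneg _))

lemma integral_fderiv_velocity_eq_zero (t : ℝ) {ψ : ℝ × ℝ → ℝ} (hψ : ContDiff ℝ 1 ψ)
    (hψc : HasCompactSupport ψ) : ∫ x, fderiv ℝ ψ x (u t x) = 0 := by
  have hd : Continuous (fderiv ℝ ψ) := hψ.continuous_fderiv one_ne_zero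
  have key : ∀ f : ℝ × ℝ → ℝ, Continuous f → HasCompactSupport f →
      Integrable fun x => fderiv ℝ ψ x (planeVel f x) := by
    intro f hf hc
    refine ((hd.norm.integrable_of_hasCompactSupport (hψc.fderiv ℝ).norm).mul_const
      ((∫ y, profile (f y)) + ∫ z : ℝ × ℝ, radialBound ‖z‖)).mono' ?_ (.of_forall fun x => ?_)
    · exact isBoundedBilinearMap_apply.continuous.comp_aestronglyMeasurable
        (hd.stronglyMeasurable.aestronglyMeasurable.prodMk
          (stronglyMeasurable_planeVel hf).aestronglyMeasurable)
    · exact ((fderiv ℝ ψ x).le_opNorm _).trans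
        (mul_le_mul_of_nonneg_left (norm_planeVel_le hf hc x) (norm_nonneg _))
  simp only [velocity_eq hsol, map_sub]
  rw [integral_sub (key _ (continuous_slice hsol t) (hsol.compactSupp t))
      (key _ (continuous_comp_pbar hsol t) (hasCompactSupport_comp_pbar hsol t)),
    integral_fderiv_planeVel_eq_zero (continuous_slice hsol t) (hsol.compactSupp t) hψ hψc,
    integral_fderiv_planeVel_eq_zero (continuous_comp_pbar hsol t)
      (hasCompactSupport_comp_pbar hsol t) hψ hψc, sub_zero]

end basic

lemma hasDerivAt_slice {f : ℝ × (ℝ × ℝ) → ℝ} (hf : ContDiff ℝ 1 f) (t : ℝ) (x : ℝ × ℝ) :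
    HasDerivAt (fun s => f (s, x)) (fderiv ℝ f (t, x) (1, 0)) t :=
  (hf.differentiable one_ne_zero (t, x)).hasFDerivAt.comp_hasDerivAt t
    ((hasDerivAt_id t).prodMk (hasDerivAt_const t x))

lemma fderiv_slice {f : ℝ × (ℝ × ℝ) → ℝ} (hf : ContDiff ℝ 1 f) (t : ℝ) (x v : ℝ × ℝ) :
    fderiv ℝ (fun y => f (t, y)) x v = fderiv ℝ f (t, x) (0, v) := by
  have h : HasFDerivAt (fun y : ℝ × ℝ => f (t, y))
      ((fderiv ℝ f (t, x)).comp ((0 : ℝ × ℝ →L[ℝ] ℝ).prod (ContinuousLinearMap.id ℝ (ℝ × ℝ)))) x :=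
    (hf.differentiable one_ne_zero (t, x)).hasFDerivAt.comp x
      ((hasFDerivAt_const t x).prodMk (hasFDerivAt_id x))
  rw [h.fderiv]
  rfl

/-- The vorticity at time `t` vanishes outside the (supremum norm) ball of radius `R`. -/
def VanishesOff (ω : ℝ → ℝ × ℝ → ℝ) (t R : ℝ) : Prop := ∀ x, R < ‖x‖ → ω t x = 0

lemma VanishesOff.mono {t R R' : ℝ} (h : VanishesOff ω t R) (hR : R ≤ R') :
    VanishesOff ω t R' := fun x hx => h x (hR.trans_lt hx)

lemma hasDerivAt_integral_of_contDiff {f : ℝ × (ℝ × ℝ) → ℝ} (hf : ContDiff ℝ 1 f) (R t : ℝ) :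
    HasDerivAt (fun s => ∫ x in Metric.closedBall (0 : ℝ × ℝ) R, f (s, x))
      (∫ x in Metric.closedBall (0 : ℝ × ℝ) R, fderiv ℝ f (t, x) (1, 0)) t := by
  have hK : IsCompact (Metric.closedBall (0 : ℝ × ℝ) R) := isCompact_closedBall _ _
  have hd : Continuous fun q : ℝ × (ℝ × ℝ) => fderiv ℝ f q (1, 0) :=
    (hf.continuous_fderiv one_ne_zero).clm_apply continuous_const
  obtain ⟨C, hC⟩ := ((isCompact_Icc (a := t - 1) (b := t + 1)).prod hK).exists_bound_of_continuousOn
    hd.continuousOn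
  refine (hasDerivAt_integral_of_dominated_loc_of_deriv_le (bound := fun _ => C)
    (F' := fun s x => fderiv ℝ f (s, x) (1, 0))
    (Icc_mem_nhds (by linarith : t - 1 < t) (by linarith : t < t + 1)) ?_ ?_ ?_ ?_ ?_ ?_).2
  · exact .of_forall fun s =>
      (hf.continuous.comp (Continuous.prodMk_right s)).aestronglyMeasurable
  · exact (hf.continuous.comp (Continuous.prodMk_right t)).continuousOn.integrableOn_compact hK
  · exact (hd.comp (Continuous.prodMk_right t)).aestronglyMeasurable
  · exact (ae_restrict_iff' hK.measurableSet).2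
      (.of_forall fun x hx s hs => hC (s, x) ⟨hs, hx⟩)
  · exact integrableOn_const hK.measure_lt_top.ne
  · exact .of_forall fun x s _ => hasDerivAt_slice hf s x

section transport

variable (hsol : IsEulerSol ω u)
include hsol

lemma fderiv_along_flow_eq_zero {t : ℝ} (ht : 0 ≤ t) (x : ℝ × ℝ) :
    fderiv ℝ (fun q : ℝ × (ℝ × ℝ) => ω q.1 q.2) (t, x) (1, u t x) = 0 := by
  have hsplit : ((1 : ℝ), u t x) = (1, 0) + (0, u t x) := by simp
  have h1 := (hasDerivAt_slice (contDiff_uncurry hsol) t x).deriv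
  have h2 := fderiv_slice (contDiff_uncurry hsol) t x (u t x)
  simp only at h1 h2
  rw [hsplit, map_add, ← h1, ← h2]
  by_cases hx : x ∈ Hplane
  · exact hsol.transport t ht x hx
  · have hx' : x.2 ≤ 0 := not_lt.1 hx
    have h3 : (fun s => ω s x) = fun _ => 0 :=
      funext fun s => eq_zero_of_snd_nonpos hsol s hx'
    have h4 : ω t =ᶠ[𝓝 x] fun _ => 0 :=
      notMem_tsupport_iff_eventuallyEq.1 fun h => hx (hsol.suppIn t h)
    have h5 : fderiv ℝ (fun y => ω t y) x = 0 := by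
      rw [h4.fderiv_eq]
      simp
    rw [h3, h5]
    simp

lemma hasCompactSupport_mul_comp (t : ℝ) (p : ℝ × ℝ → ℝ) {g : ℝ → ℝ} (hg0 : g 0 = 0) :
    HasCompactSupport fun x => p x * g (ω t x) :=
  HasCompactSupport.mul_left ((hsol.compactSupp t).comp_left hg0)

/-- The weak form of the transport equation, with a time-dependent weight. -/
lemma hasDerivAt_weighted {t R : ℝ} (ht : 0 ≤ t) (hR : VanishesOff ω t R)
    {φ : ℝ × (ℝ × ℝ) → ℝ} (hφ : ContDiff ℝ 1 φ) {g : ℝ → ℝ} (hg : ContDiff ℝ 1 g)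
    (hg0 : g 0 = 0) :
    HasDerivAt (fun s => ∫ x in Metric.closedBall (0 : ℝ × ℝ) R, φ (s, x) * g (ω s x))
      (∫ x, fderiv ℝ φ (t, x) (1, u t x) * g (ω t x)) t := by
  have hΩ := contDiff_uncurry hsol
  set Φ : ℝ × (ℝ × ℝ) → ℝ := fun q => φ q * g (ω q.1 q.2) with hΦdef
  have hΦ : ContDiff ℝ 1 Φ := hφ.mul (hg.comp hΩ)
  have hslice : ContDiff ℝ 1 fun x => Φ (t, x) := hΦ.comp (contDiff_const.prodMk contDiff_id)
  have hcs : HasCompactSupport fun x => Φ (t, x) := hasCompactSupport_mul_comp hsol t _ hg0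
  have hflow : ∀ x, fderiv ℝ Φ (t, x) (1, u t x) =
      fderiv ℝ φ (t, x) (1, u t x) * g (ω t x) := by
    intro x
    have h1 := ((hg.differentiable one_ne_zero (ω t x)).hasDerivAt.comp_hasFDerivAt
      (f := fun q : ℝ × (ℝ × ℝ) => ω q.1 q.2) (t, x)
      (hΩ.differentiable one_ne_zero (t, x)).hasFDerivAt)
    have h2 : HasFDerivAt Φ _ (t, x) :=
      (hφ.differentiable one_ne_zero (t, x)).hasFDerivAt.mul h1
    rw [h2.fderiv]
    simp [fderiv_along_flow_eq_zero hsol ht x, mul_comm]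
  have htime : ∀ x, fderiv ℝ Φ (t, x) (1, 0) =
      fderiv ℝ φ (t, x) (1, u t x) * g (ω t x) - fderiv ℝ (fun y => Φ (t, y)) x (u t x) := by
    intro x
    rw [fderiv_slice hΦ, ← hflow, ← map_sub]
    simp
  have hint1 : Integrable fun x => fderiv ℝ (fun y => Φ (t, y)) x (u t x) :=
    integrable_clm_velocity hsol t (hslice.continuous_fderiv one_ne_zero) (hcs.fderiv ℝ)
  have hcφ : Continuous fun x => fderiv ℝ φ (t, x) :=
    (hφ.continuous_fderiv one_ne_zero).comp (Continuous.prodMk_right t)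
  have hcg : Continuous fun x => g (ω t x) := hg.continuous.comp (continuous_slice hsol t)
  have hint2 : Integrable fun x => fderiv ℝ φ (t, x) (1, u t x) * g (ω t x) := by
    have hA : Integrable fun x => (g (ω t x) • (fderiv ℝ φ (t, x)).comp
        (ContinuousLinearMap.inr ℝ ℝ (ℝ × ℝ))) (u t x) :=
      integrable_clm_velocity hsol t (hcg.smul (hcφ.clm_comp continuous_const))
        (((hsol.compactSupp t).comp_left hg0).smul_right)
    have hB : Integrable fun x => fderiv ℝ φ (t, x) (1, 0) * g (ω t x) :=
      ((hcφ.clm_apply continuous_const).mul hcg).integrable_of_hasCompactSupport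
        (hasCompactSupport_mul_comp hsol t _ hg0)
    refine (hA.add hB).congr (.of_forall fun x => ?_)
    have hsplit : fderiv ℝ φ (t, x) (1, u t x) =
        fderiv ℝ φ (t, x) (1, 0) + fderiv ℝ φ (t, x) (0, u t x) := by
      rw [← map_add]
      simp
    simp [hsplit]
    ring
  have hder := hasDerivAt_integral_of_contDiff hΦ R t
  convert hder using 1
  have hzero : ∀ x, x ∉ Metric.closedBall (0 : ℝ × ℝ) R → fderiv ℝ Φ (t, x) (1, 0) = 0 := by
    intro x hx
    have hx' : R < ‖x‖ := by simpa using hx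
    have hev : (fun y => Φ (t, y)) =ᶠ[𝓝 x] fun _ => 0 := by
      filter_upwards [(isOpen_lt continuous_const continuous_norm).mem_nhds hx'] with y hy
      simp [hΦdef, hR y hy, hg0]
    rw [htime, hev.fderiv_eq, hR x hx', hg0]
    simp
  rw [setIntegral_eq_integral_of_forall_compl_eq_zero hzero]
  simp only [htime]
  rw [integral_sub hint2 hint1, integral_fderiv_velocity_eq_zero hsol t hslice hcs, sub_zero]

end transport

lemma hasDerivAt_max_zero_sq (s : ℝ) : HasDerivAt (fun s : ℝ => max s 0 ^ 2) (2 * max s 0) s := by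
  rcases lt_trichotomy s 0 with h | rfl | h
  · rw [max_eq_right h.le, mul_zero]
    refine (hasDerivAt_const s (0 : ℝ)).congr_of_eventuallyEq ?_
    filter_upwards [Iio_mem_nhds h] with y hy
    rw [max_eq_right (le_of_lt hy)]
    norm_num
  · rw [max_self, mul_zero]
    refine .of_isLittleO ?_
    have h1 : (fun x : ℝ => x ^ 2) =o[𝓝 0] fun x => x := by
      simpa using Asymptotics.isLittleO_pow_id (𝕜 := ℝ) one_lt_two
    refine Asymptotics.IsBigO.trans_isLittleO (.of_bound 1 (.of_forall fun x => ?_))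
      (by simpa using h1)
    rcases le_total x 0 with h | h <;> simp [h, sq_nonneg]
  · rw [max_eq_left h.le]
    refine HasDerivAt.congr_of_eventuallyEq (f := fun s : ℝ => s ^ 2)
      (by simpa using hasDerivAt_pow 2 s) ?_
    filter_upwards [Ioi_mem_nhds h] with y hy
    rw [max_eq_left (le_of_lt hy)]

lemma contDiff_max_zero_sq : ContDiff ℝ 1 fun s : ℝ => max s 0 ^ 2 := by
  rw [contDiff_one_iff_deriv]
  refine ⟨fun s => (hasDerivAt_max_zero_sq s).differentiableAt, ?_⟩
  rw [funext fun s => (hasDerivAt_max_zero_sq s).deriv]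
  fun_prop

lemma setIntegral_closedBall_eq {t R : ℝ} (hR : VanishesOff ω t R) (p : ℝ × ℝ → ℝ) {g : ℝ → ℝ}
    (hg0 : g 0 = 0) :
    ∫ x in Metric.closedBall (0 : ℝ × ℝ) R, p x * g (ω t x) = ∫ x, p x * g (ω t x) := by
  refine setIntegral_eq_integral_of_forall_compl_eq_zero fun x hx => ?_
  have hx' : R < ‖x‖ := by simpa using hx
  rw [hR x hx', hg0, mul_zero]

section monotonicity

variable (hsol : IsEulerSol ω u)
include hsol

lemma weighted_integral_le {a b R : ℝ} (ha : 0 ≤ a) (hab : a ≤ b)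
    (hR : ∀ s ∈ Icc a b, VanishesOff ω s R)
    {φ : ℝ × (ℝ × ℝ) → ℝ} (hφ : ContDiff ℝ 1 φ) {g : ℝ → ℝ} (hg : ContDiff ℝ 1 g)
    (hg0 : g 0 = 0)
    (hneg : ∀ s ∈ Icc a b, ∫ x, fderiv ℝ φ (s, x) (1, u s x) * g (ω s x) ≤ 0) :
    ∫ x, φ (b, x) * g (ω b x) ≤ ∫ x, φ (a, x) * g (ω a x) := by
  have hder : ∀ s ∈ Icc a b, HasDerivAt
      (fun s => ∫ x in Metric.closedBall (0 : ℝ × ℝ) R, φ (s, x) * g (ω s x))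
      (∫ x, fderiv ℝ φ (s, x) (1, u s x) * g (ω s x)) s :=
    fun s hs => hasDerivAt_weighted hsol (ha.trans hs.1) (hR s hs) hφ hg hg0
  have hanti := antitoneOn_of_deriv_nonpos (convex_Icc a b)
    (fun s hs => (hder s hs).continuousAt.continuousWithinAt)
    (fun s hs => (hder s (interior_subset hs)).differentiableAt.differentiableWithinAt)
    (fun s hs => by
      rw [(hder s (interior_subset hs)).deriv]
      exact hneg s (interior_subset hs))
  have := hanti (left_mem_Icc.2 hab) (right_mem_Icc.2 hab) hab
  simp only at this
  rwa [setIntegral_closedBall_eq (hR b (right_mem_Icc.2 hab)) (fun x => φ (b, x)) hg0,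
    setIntegral_closedBall_eq (hR a (left_mem_Icc.2 hab)) (fun x => φ (a, x)) hg0] at this

lemma integral_comp_eq {a b R : ℝ} (ha : 0 ≤ a) (hab : a ≤ b)
    (hR : ∀ s ∈ Icc a b, VanishesOff ω s R) {g : ℝ → ℝ} (hg : ContDiff ℝ 1 g)
    (hg0 : g 0 = 0) : ∫ x, g (ω b x) = ∫ x, g (ω a x) := by
  have h : ∀ c : ℝ, ∫ x, c * g (ω b x) ≤ ∫ x, c * g (ω a x) := fun c =>
    weighted_integral_le hsol ha hab hR (φ := fun _ => c) contDiff_const hg hg0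
      (fun s _ => by simp)
  have h1 := h 1
  have h2 := h (-1)
  simp only [one_mul, neg_mul, integral_neg] at h1 h2
  linarith

lemma eq_zero_of_integral_nonpos {t : ℝ} {p : ℝ × ℝ → ℝ} (hp : Continuous p)
    (hp0 : ∀ x, 0 ≤ p x) {g : ℝ → ℝ} (hg : Continuous g) (hg0 : g 0 = 0) (hgn : ∀ s, 0 ≤ g s)
    (h : ∫ x, p x * g (ω t x) ≤ 0) (x : ℝ × ℝ) : p x * g (ω t x) = 0 := by
  have hnn : ∀ x, 0 ≤ p x * g (ω t x) := fun x => mul_nonneg (hp0 x) (hgn _)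
  have hc : Continuous fun x => p x * g (ω t x) :=
    hp.mul (hg.comp (continuous_slice hsol t))
  have hi : Integrable fun x => p x * g (ω t x) :=
    hc.integrable_of_hasCompactSupport (hasCompactSupport_mul_comp hsol t p hg0)
  have h0 := (integral_eq_zero_iff_of_nonneg hnn hi).1 (le_antisymm h (integral_nonneg hnn))
  exact congrFun ((hc.ae_eq_iff_eq volume continuous_const).1 h0) x

/-- Vorticity enters a half-space with speed at most `C`, forwards and backwards in time. -/
lemma halfSpace_propagation {a b R C ρ : ℝ} (ha : 0 ≤ a) (hab : a ≤ b)
    (hR : ∀ s ∈ Icc a b, VanishesOff ω s R) (hC : ∀ s ∈ Icc a b, ∀ x, ‖u s x‖ ≤ C)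
    (L : ℝ × ℝ →L[ℝ] ℝ) (hL : ∀ v, L v ≤ ‖v‖) :
    ((∀ x, ρ < L x → ω a x = 0) → ∀ x, ρ + C * (b - a) < L x → ω b x = 0) ∧
    ((∀ x, ρ < L x → ω b x = 0) → ∀ x, ρ + C * (b - a) < L x → ω a x = 0) := by
  have hLabs : ∀ s ∈ Icc a b, ∀ x, |L (u s x)| ≤ C := fun s hs x => by
    refine abs_le.2 ⟨?_, (hL _).trans (hC s hs x)⟩
    have := (hL (-(u s x))).trans ((norm_neg _).trans_le (hC s hs x))
    rw [map_neg] at this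
    linarith
  have hφ : ∀ κ c : ℝ, ContDiff ℝ 1
      fun q : ℝ × (ℝ × ℝ) => max (L q.2 - ρ - κ * (q.1 - c)) 0 ^ 2 := fun κ c =>
    contDiff_max_zero_sq.comp (by fun_prop)
  have hdφ : ∀ κ c s x v, fderiv ℝ (fun q : ℝ × (ℝ × ℝ) => max (L q.2 - ρ - κ * (q.1 - c)) 0 ^ 2)
      (s, x) (1, v) = 2 * max (L x - ρ - κ * (s - c)) 0 * (L v - κ) := by
    intro κ c s x v
    have h1 : HasFDerivAt (fun q : ℝ × (ℝ × ℝ) => L q.2 - ρ - κ * (q.1 - c))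
        (L.comp (ContinuousLinearMap.snd ℝ ℝ (ℝ × ℝ)) -
          κ • ContinuousLinearMap.fst ℝ ℝ (ℝ × ℝ)) (s, x) := by
      refine HasFDerivAt.sub ?_ ?_
      · exact (L.hasFDerivAt.comp (s, x) hasFDerivAt_snd).sub_const ρ
      · exact (hasFDerivAt_fst.sub_const c).const_mul κ
    have h2 := (hasDerivAt_max_zero_sq (L x - ρ - κ * (s - c))).comp_hasFDerivAt
      (f := fun q : ℝ × (ℝ × ℝ) => L q.2 - ρ - κ * (q.1 - c)) (s, x) h1
    have h3 : HasFDerivAt (fun q : ℝ × (ℝ × ℝ) => max (L q.2 - ρ - κ * (q.1 - c)) 0 ^ 2) _ (s, x) :=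
      h2
    rw [h3.fderiv]
    simp
  have hg : ContDiff ℝ 1 fun s : ℝ => s ^ 2 := contDiff_id.pow 2
  have hfin : ∀ {t κ c : ℝ}, (∫ x, max (L x - ρ - κ * (t - c)) 0 ^ 2 * ω t x ^ 2) ≤ 0 →
      ∀ x, ρ + κ * (t - c) < L x → ω t x = 0 := by
    intro t κ c h x hx
    have h0 := eq_zero_of_integral_nonpos hsol (p := fun x => max (L x - ρ - κ * (t - c)) 0 ^ 2)
      (by fun_prop) (fun x => sq_nonneg _) hg.continuous (by norm_num) (fun s => sq_nonneg s) h x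
    rcases mul_eq_zero.1 h0 with h1 | h1
    · rw [max_eq_left (by linarith)] at h1
      have := pow_eq_zero_iff two_ne_zero |>.1 h1
      linarith
    · exact pow_eq_zero_iff two_ne_zero |>.1 h1
  have hinit : ∀ {t κ : ℝ}, (∀ x, ρ < L x → ω t x = 0) →
      (∫ x, max (L x - ρ - κ * (t - t)) 0 ^ 2 * ω t x ^ 2) = 0 := by
    intro t κ h
    refine integral_eq_zero_of_ae (.of_forall fun x => ?_)
    rcases lt_or_ge ρ (L x) with hx | hx
    · simp [h x hx]
    · simp [max_eq_right (by linarith : L x - ρ ≤ 0)]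
  constructor
  · intro h
    refine hfin ((weighted_integral_le hsol ha hab hR (hφ C a) hg (by norm_num)
      fun s hs => ?_).trans_eq (hinit h))
    refine integral_nonpos fun x => ?_
    rw [hdφ]
    refine mul_nonpos_of_nonpos_of_nonneg (mul_nonpos_of_nonneg_of_nonpos (by positivity) ?_)
      (sq_nonneg _)
    linarith [(abs_le.1 (hLabs s hs x)).2]
  · intro h x hx
    refine hfin (t := a) (κ := -C) (c := b) (le_of_le_of_eq ?_ (hinit (κ := -C) h)) x
      (by linarith)
    have := weighted_integral_le hsol ha hab hR (hφ (-C) b).neg hg (by norm_num) fun s hs => ?_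
    · simp only [neg_mul, integral_neg, neg_le_neg_iff] at this
      simpa using this
    · refine integral_nonpos fun x => ?_
      have hn : fderiv ℝ (fun q : ℝ × (ℝ × ℝ) => -(max (L q.2 - ρ - -C * (q.1 - b)) 0 ^ 2)) (s, x)
          = -fderiv ℝ (fun q : ℝ × (ℝ × ℝ) => max (L q.2 - ρ - -C * (q.1 - b)) 0 ^ 2) (s, x) :=
        fderiv_fun_neg
      rw [hn, neg_apply, hdφ]
      refine mul_nonpos_of_nonpos_of_nonneg (neg_nonpos.2 (mul_nonneg (by positivity) ?_))
        (sq_nonneg _)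
      linarith [(abs_le.1 (hLabs s hs x)).1]

end monotonicity

lemma vanishesOff_iff {t ρ : ℝ} : VanishesOff ω t ρ ↔
    ∀ L ∈ ({ContinuousLinearMap.fst ℝ ℝ ℝ, -ContinuousLinearMap.fst ℝ ℝ ℝ,
      ContinuousLinearMap.snd ℝ ℝ ℝ, -ContinuousLinearMap.snd ℝ ℝ ℝ} : Set (ℝ × ℝ →L[ℝ] ℝ)),
      ∀ x, ρ < L x → ω t x = 0 := by
  simp only [VanishesOff, Prod.norm_def, lt_max_iff, Real.norm_eq_abs, lt_abs, mem_insert_iff,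
    mem_singleton_iff, forall_eq_or_imp, forall_eq, neg_apply,
    ContinuousLinearMap.coe_fst', ContinuousLinearMap.coe_snd']
  grind

/-- The quantity controlling the speed of propagation at time `t`. -/
noncomputable def speedBound (ω : ℝ → ℝ × ℝ → ℝ) (t : ℝ) : ℝ :=
  2 * ((∫ y, profile (ω t y)) + ∫ z : ℝ × ℝ, radialBound ‖z‖)

lemma speedBound_nonneg (t : ℝ) : 0 ≤ speedBound ω t := by
  have h1 : 0 ≤ ∫ y, profile (ω t y) := integral_nonneg fun y => profile_nonneg _
  have h2 : 0 ≤ ∫ z : ℝ × ℝ, radialBound ‖z‖ :=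
    integral_nonneg fun z => radialBound_nonneg (norm_nonneg z)
  unfold speedBound
  linarith

section support

variable (hsol : IsEulerSol ω u)
include hsol

lemma speedBound_eq {a b R : ℝ} (ha : 0 ≤ a) (hb : 0 ≤ b)
    (hR : ∀ s ∈ uIcc a b, VanishesOff ω s R) : speedBound ω a = speedBound ω b := by
  unfold speedBound
  rcases le_total a b with hab | hab
  · rw [uIcc_of_le hab] at hR
    rw [integral_comp_eq hsol ha hab hR contDiff_profile profile_zero]
  · rw [uIcc_of_ge hab] at hR
    rw [integral_comp_eq hsol hb hab hR contDiff_profile profile_zero]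

/-- Finite speed of propagation, forwards and backwards in time. -/
lemma VanishesOff.propagate {a b R ρ : ℝ} (ha : 0 ≤ a) (hb : 0 ≤ b)
    (hR : ∀ s ∈ uIcc a b, VanishesOff ω s R) (hρ : VanishesOff ω a ρ) :
    VanishesOff ω b (ρ + speedBound ω b * |b - a|) := by
  have hC : ∀ s ∈ uIcc a b, ∀ x, ‖u s x‖ ≤ speedBound ω b := by
    intro s hs x
    have hs0 : 0 ≤ s := (le_min ha hb).trans hs.1
    rw [← speedBound_eq hsol hs0 hb fun r hr => hR r (uIcc_subset_uIcc_right hs hr)]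
    exact norm_velocity_le hsol s x
  rw [vanishesOff_iff] at hρ ⊢
  intro L hLmem
  have hL : ∀ v, L v ≤ ‖v‖ := by
    intro v
    have h1 := norm_fst_le v
    have h2 := norm_snd_le v
    rw [Real.norm_eq_abs, abs_le] at h1 h2
    simp only [mem_insert_iff, mem_singleton_iff] at hLmem
    rcases hLmem with rfl | rfl | rfl | rfl <;> simp <;> linarith
  rcases le_total a b with hab | hab
  · rw [uIcc_of_le hab] at hR hC
    rw [abs_of_nonneg (sub_nonneg.2 hab)]
    exact (halfSpace_propagation hsol ha hab hR hC L hL).1 (hρ L hLmem)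
  · rw [uIcc_of_ge hab] at hR hC
    rw [abs_of_nonpos (sub_nonpos.2 hab), neg_sub]
    exact (halfSpace_propagation hsol hb hab hR hC L hL).2 (hρ L hLmem)

lemma exists_vanishesOff (t : ℝ) : ∃ R, VanishesOff ω t R := by
  obtain ⟨R, hR⟩ := (hsol.compactSupp t).isCompact.isBounded.subset_closedBall 0
  refine ⟨R, fun x hx => image_eq_zero_of_notMem_tsupport fun h => ?_⟩
  have := hR h
  rw [mem_closedBall_zero_iff] at this
  linarith

end support

/-- Near time `t` the vorticity is supported in a common ball. -/
def LocallyBounded (ω : ℝ → ℝ × ℝ → ℝ) (t : ℝ) : Prop :=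
  ∃ ε > 0, ∃ R, ∀ s, 0 ≤ s → |s - t| < ε → VanishesOff ω s R

lemma isOpen_locallyBounded : IsOpen {t | LocallyBounded ω t} := by
  rw [Metric.isOpen_iff]
  rintro t ⟨ε, hε, R, h⟩
  refine ⟨ε / 2, by positivity, fun t' ht' => ⟨ε / 2, by positivity, R, fun s hs hst => ?_⟩⟩
  rw [Metric.mem_ball, Real.dist_eq] at ht'
  refine h s hs ?_
  linarith [abs_sub_le s t' t]

lemma exists_uniform_vanishesOff {K : Set ℝ} (hK : IsCompact K) (hK0 : ∀ s ∈ K, 0 ≤ s)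
    (h : ∀ s ∈ K, LocallyBounded ω s) : ∃ R, ∀ s ∈ K, VanishesOff ω s R := by
  refine hK.induction_on (p := fun S => ∃ R, ∀ s ∈ S, 0 ≤ s → VanishesOff ω s R)
    ⟨0, by simp⟩ ?_ ?_ ?_ |>.imp fun R hR s hs => hR s hs (hK0 s hs)
  · rintro S T hST ⟨R, hR⟩
    exact ⟨R, fun s hs => hR s (hST hs)⟩
  · rintro S T ⟨R, hR⟩ ⟨R', hR'⟩
    refine ⟨max R R', fun s hs hs0 => ?_⟩
    rcases hs with hs | hs
    · exact (hR s hs hs0).mono (le_max_left _ _)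
    · exact (hR' s hs hs0).mono (le_max_right _ _)
  · intro t ht
    obtain ⟨ε, hε, R, hR⟩ := h t ht
    exact ⟨Metric.ball t ε, mem_nhdsWithin_of_mem_nhds (Metric.ball_mem_nhds t hε), R,
      fun s hs hs0 => hR s hs0 (by rwa [Metric.mem_ball, Real.dist_eq] at hs)⟩

section baire

variable (hsol : IsEulerSol ω u)
include hsol

/-- If all times between `a` and `t` except possibly `a` are locally bounded, then
the support at time `t` is controlled by that at time `a`. -/
lemma vanishesOff_of_locallyBounded {a t n : ℝ} (ha : 0 ≤ a) (ht : 0 ≤ t)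
    (hn : VanishesOff ω a n) (h : ∀ s ∈ uIcc a t, s ≠ a → LocallyBounded ω s) :
    VanishesOff ω t (n + speedBound ω a * |t - a|) := by
  obtain ⟨Rt, hRt⟩ := exists_vanishesOff hsol t
  have huni : ∀ s ∈ uIcc a t,
      VanishesOff ω s (max n (Rt + speedBound ω t * |t - a|)) := by
    intro s hs
    by_cases hsa : s = a
    · rw [hsa]
      exact hn.mono (le_max_left _ _)
    have hs0 : 0 ≤ s := (le_min ha ht).trans hs.1
    have hsub : uIcc t s ⊆ uIcc a t := by
      rw [uIcc_comm t s]
      exact uIcc_subset_uIcc_right hs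
    obtain ⟨R, hR⟩ := exists_uniform_vanishesOff (ω := ω) (isCompact_uIcc (a := t) (b := s))
      (fun r hr => (le_min ht hs0).trans hr.1)
      (fun r hr => h r (hsub hr) (by
        rintro rfl
        rw [uIcc_comm] at hr
        exact hsa (eq_of_mem_uIcc_of_mem_uIcc hs hr)))
    have hp := hRt.propagate hsol ht hs0 hR
    rw [← speedBound_eq hsol ht hs0 hR] at hp
    refine hp.mono (le_max_of_le_right ?_)
    have : |s - t| ≤ |t - a| := by
      have := abs_sub_right_of_mem_uIcc hs
      rwa [abs_sub_comm s t]
    have h2 := mul_le_mul_of_nonneg_left this (speedBound_nonneg (ω := ω) t)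
    linarith
  rw [speedBound_eq hsol ha ht huni]
  exact hn.propagate hsol ha ht huni

lemma isClosed_vanishesOff (R : ℝ) : IsClosed {t | VanishesOff ω t R} := by
  simp only [VanishesOff, ofPred_forall]
  refine isClosed_iInter fun x => isClosed_iInter fun _ => ?_
  exact isClosed_eq ((contDiff_uncurry hsol).continuous.comp (Continuous.prodMk_left x))
    continuous_const

lemma exists_speedBound_le (n t₀ ε : ℝ) :
    ∃ C, ∀ a, |a - t₀| ≤ ε → VanishesOff ω a n → speedBound ω a ≤ C := by
  have hc : Continuous fun a => ∫ x in Metric.closedBall (0 : ℝ × ℝ) n, profile (ω a x) := by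
    rw [continuous_iff_continuousAt]
    exact fun a => (hasDerivAt_integral_of_contDiff
      (contDiff_profile.comp (contDiff_uncurry hsol)) n a).continuousAt
  obtain ⟨C, hC⟩ := (isCompact_closedBall t₀ ε).exists_bound_of_continuousOn hc.continuousOn
  refine ⟨2 * (C + ∫ z : ℝ × ℝ, radialBound ‖z‖), fun a ha han => ?_⟩
  have h1 := (le_abs_self _).trans (hC a (by rwa [Metric.mem_closedBall, Real.dist_eq]))
  have h2 := setIntegral_closedBall_eq han (fun _ => 1) profile_zero
  simp only [one_mul] at h2
  rw [h2] at h1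
  unfold speedBound
  linarith

/-- A Baire category argument: the support of the vorticity is bounded locally uniformly
in time. -/
lemma locallyBounded_of_nonneg {t : ℝ} (ht : 0 ≤ t) : LocallyBounded ω t := by
  by_contra hbad
  set B : Set ℝ := {s | 0 ≤ s} ∩ {s | LocallyBounded ω s}ᶜ with hB
  have hBclosed : IsClosed B :=
    (isClosed_le continuous_const continuous_id).inter isOpen_locallyBounded.isClosed_compl
  have : CompleteSpace B := hBclosed.completeSpace_coe
  have : Nonempty B := ⟨⟨t, ht, hbad⟩⟩
  obtain ⟨n, ⟨t₀, ht₀B⟩, ht₀⟩ := nonempty_interior_of_iUnion_of_closed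
    (f := fun n : ℕ => {s : B | VanishesOff ω s n})
    (fun n => (isClosed_vanishesOff hsol n).preimage continuous_subtype_val)
    (by
      refine eq_univ_of_forall fun s => ?_
      obtain ⟨R, hR⟩ := exists_vanishesOff hsol (s : ℝ)
      obtain ⟨n, hn⟩ := exists_nat_ge R
      exact mem_iUnion.2 ⟨n, hR.mono hn⟩)
  obtain ⟨ε, hε, hball⟩ := Metric.mem_nhds_iff.1 (mem_interior_iff_mem_nhds.1 ht₀)
  have hnB : ∀ s ∈ B, |s - t₀| < ε → VanishesOff ω s n := fun s hs hst =>
    hball (show (⟨s, hs⟩ : B) ∈ Metric.ball ⟨t₀, ht₀B⟩ ε by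
      rwa [Metric.mem_ball, Subtype.dist_eq, Real.dist_eq])
  obtain ⟨C, hC⟩ := exists_speedBound_le hsol n t₀ ε
  have hC0 : 0 ≤ C := (speedBound_nonneg (ω := ω) t₀).trans
    (hC t₀ (by simpa using hε.le) (hnB t₀ ht₀B (by simpa using hε)))
  refine ht₀B.2 ⟨ε, hε, n + C * ε, fun s hs hst => ?_⟩
  obtain ⟨a, ⟨haB, haI⟩, hdist⟩ := ((isCompact_uIcc (a := t₀) (b := s)).inter_left
    hBclosed).exists_infDist_eq_dist ⟨t₀, ht₀B, left_mem_uIcc⟩ s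
  have hat₀ : |a - t₀| ≤ |s - t₀| := by
    have := abs_sub_left_of_mem_uIcc haI
    linarith
  have hsa : |s - a| ≤ |s - t₀| := abs_sub_right_of_mem_uIcc haI
  have han := hnB a haB (hat₀.trans_lt hst)
  have hv := vanishesOff_of_locallyBounded hsol haB.1 hs han (fun r hr hra => by
    by_contra hrbad
    have hr0 : 0 ≤ r := (le_min haB.1 hs).trans hr.1
    have hrI : r ∈ uIcc t₀ s := uIcc_subset_uIcc_right haI hr
    have h1 := Metric.infDist_le_dist_of_mem (x := s)
      (show r ∈ B ∩ uIcc t₀ s from ⟨⟨hr0, hrbad⟩, hrI⟩)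
    rw [hdist, Real.dist_eq, Real.dist_eq] at h1
    apply hra
    rcases le_total a s with h2 | h2
    · rw [uIcc_of_le h2] at hr
      rw [abs_of_nonneg (by linarith), abs_of_nonneg (by linarith [hr.2])] at h1
      linarith [hr.1]
    · rw [uIcc_of_ge h2] at hr
      rw [abs_of_nonpos (by linarith), abs_of_nonpos (by linarith [hr.1])] at h1
      linarith [hr.2])
  refine hv.mono ?_
  have h1 := hC a (hat₀.trans hst.le) han
  have := mul_le_mul h1 (hsa.trans hst.le) (abs_nonneg _) hC0
  linarith

/-- On bounded time intervals the vorticity is supported in a common ball. -/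
lemma exists_vanishesOff_Icc (T : ℝ) : ∃ R, ∀ s ∈ Icc 0 T, VanishesOff ω s R :=
  exists_uniform_vanishesOff isCompact_Icc (fun _ hs => hs.1)
    fun _ hs => locallyBounded_of_nonneg hsol hs.1

end baire

lemma exp_sub_exp_abs_le (a b : ℝ) :
    |Real.exp a - Real.exp b| ≤ |a - b| * (Real.exp a + Real.exp b) := by
  wlog h : b ≤ a generalizing a b
  · rw [abs_sub_comm, abs_sub_comm a b, add_comm (Real.exp a)]
    exact this b a (le_of_not_ge h)
  rw [abs_of_nonneg (sub_nonneg.2 (Real.exp_le_exp.2 h)), abs_of_nonneg (sub_nonneg.2 h)]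
  have h1 : Real.exp b = Real.exp a * Real.exp (b - a) := by rw [← Real.exp_add]; ring_nf
  have h2 := Real.add_one_le_exp (b - a)
  have h3 := mul_le_mul_of_nonneg_left h2 (Real.exp_pos a).le
  have h4 : 0 ≤ (a - b) * Real.exp b := mul_nonneg (sub_nonneg.2 h) (Real.exp_pos b).le
  linarith

lemma planeKer_fst_neg (z : ℝ × ℝ) : (planeKer (-z)).1 = -(planeKer z).1 := by
  simp only [planeKer_fst, Prod.snd_neg, Prod.fst_neg, neg_sq, neg_div, neg_neg]

lemma abs_fst_mul_abs_planeKer_fst_le (z : ℝ × ℝ) : |z.1| * |(planeKer z).1| ≤ 1 := by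
  have hpi : 1 ≤ 2 * Real.pi := by linarith [Real.pi_gt_three]
  rw [planeKer_fst, abs_neg, abs_div, ← mul_div_assoc, ← abs_mul]
  refine div_le_one_of_le₀ ?_ (abs_nonneg _)
  rw [abs_of_nonneg (a := 2 * Real.pi * (z.1 ^ 2 + z.2 ^ 2)) (by positivity)]
  have h1 : |z.1 * z.2| ≤ z.1 ^ 2 + z.2 ^ 2 :=
    abs_le.2 ⟨by nlinarith [sq_nonneg (z.1 + z.2)], by nlinarith [sq_nonneg (z.1 - z.2)]⟩
  nlinarith [sq_nonneg z.1, sq_nonneg z.2]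

section planeVel

variable {f : ℝ × ℝ → ℝ}

lemma planeVel_fst (hf : Continuous f) (hc : HasCompactSupport f) (x : ℝ × ℝ) :
    (planeVel f x).1 = ∫ y, f y * (planeKer (x - y)).1 :=
  fst_integral (integrable_smul_planeKer hf hc x)

lemma integrable_prod_planeKer_fst (hf : Continuous f) (hc : HasCompactSupport f)
    {w : ℝ × ℝ → ℝ} (hw : Continuous w) (hwc : HasCompactSupport w) :
    Integrable (fun p : (ℝ × ℝ) × (ℝ × ℝ) => w p.1 * (f p.2 * (planeKer (p.1 - p.2)).1))
      (volume.prod volume) := by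
  have hnd : Integrable fun x => ‖w x‖ :=
    hw.norm.integrable_of_hasCompactSupport hwc.norm
  have b1 := hnd.mul_prod (integrable_profile_comp hf hc)
  have b2 := (hnd.convolution_integrand (ContinuousLinearMap.mul ℝ ℝ)
    integrable_radialBound).swap
  refine (b1.add b2).mono' ?_ (.of_forall fun p => ?_)
  · exact ((hw.measurable.comp measurable_fst).mul
      (measurable_smul_planeKer hf).fst).aestronglyMeasurable
  · have h1 : ‖f p.2 * (planeKer (p.1 - p.2)).1‖ ≤ ‖f p.2 • planeKer (p.1 - p.2)‖ :=
      norm_fst_le (f p.2 • planeKer (p.1 - p.2))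
    have h2 := mul_le_mul_of_nonneg_left (h1.trans (norm_smul_planeKer_le f p.1 p.2))
      (norm_nonneg (w p.1))
    have h3 : ‖p.2 - p.1‖ = ‖p.1 - p.2‖ := norm_sub_rev _ _
    simp only [Pi.add_apply, Function.comp_apply, Prod.fst_swap,
      Prod.snd_swap, ContinuousLinearMap.mul_apply', h3]
    rw [norm_mul]
    linarith

/-- Symmetrizing the kernel gains a factor `lam` in the leftward drift of the exponential
moment. -/
lemma neg_integral_exp_planeVel_le (hf : Continuous f) (hc : HasCompactSupport f)
    (hf0 : ∀ x, 0 ≤ f x) {lam : ℝ} (hlam : 0 ≤ lam) :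
    -∫ x, Real.exp (-lam * x.1) * f x * (planeVel f x).1 ≤
      lam * (∫ x, f x) * ∫ x, Real.exp (-lam * x.1) * f x := by
  have hw : Continuous fun x : ℝ × ℝ => Real.exp (-lam * x.1) * f x := by fun_prop
  have hwc : HasCompactSupport fun x : ℝ × ℝ => Real.exp (-lam * x.1) * f x := hc.mul_left
  set A : (ℝ × ℝ) × (ℝ × ℝ) → ℝ := fun p =>
    Real.exp (-lam * p.1.1) * f p.1 * (f p.2 * (planeKer (p.1 - p.2)).1) with hA
  have hAi : Integrable A (volume.prod volume) := integrable_prod_planeKer_fst hf hc hw hwc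
  have h1 : ∫ x, Real.exp (-lam * x.1) * f x * (planeVel f x).1 = ∫ p, A p ∂(volume.prod volume) := by
    rw [integral_prod _ hAi]
    refine integral_congr_ae (.of_forall fun x => ?_)
    simp only [hA]
    rw [planeVel_fst hf hc, integral_const_mul]
  have h2 : ∫ p, A p.swap ∂(volume.prod volume) = ∫ p, A p ∂(volume.prod volume) :=
    integral_prod_swap A
  have hfi : Integrable f := hf.integrable_of_hasCompactSupport hc
  have hwi := hw.integrable_of_hasCompactSupport (μ := volume) hwc
  have hB1 := hwi.mul_prod hfi
  have hB2 := hfi.mul_prod hwi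
  have hpt : ∀ p, -(A p + A p.swap) ≤ lam * ((Real.exp (-lam * p.1.1) * f p.1) * f p.2 +
      f p.1 * (Real.exp (-lam * p.2.1) * f p.2)) := by
    rintro ⟨x, y⟩
    have hodd : (planeKer (y - x)).1 = -(planeKer (x - y)).1 := by
      rw [← planeKer_fst_neg, neg_sub]
    have hff : 0 ≤ f x * f y := mul_nonneg (hf0 x) (hf0 y)
    have e1 := exp_sub_exp_abs_le (-lam * x.1) (-lam * y.1)
    have e2 : |-lam * x.1 - -lam * y.1| = lam * |(x - y).1| := by
      rw [← mul_sub, abs_mul, abs_neg, abs_of_nonneg hlam, Prod.fst_sub]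
    rw [e2] at e1
    have e3 := abs_fst_mul_abs_planeKer_fst_le (x - y)
    have hE : 0 ≤ Real.exp (-lam * x.1) + Real.exp (-lam * y.1) := by positivity
    have e4 : |(Real.exp (-lam * x.1) - Real.exp (-lam * y.1)) * (planeKer (x - y)).1| ≤
        lam * (Real.exp (-lam * x.1) + Real.exp (-lam * y.1)) := by
      rw [abs_mul]
      calc _ ≤ lam * |(x - y).1| * (Real.exp (-lam * x.1) + Real.exp (-lam * y.1)) *
            |(planeKer (x - y)).1| := mul_le_mul_of_nonneg_right e1 (abs_nonneg _)
        _ = lam * (Real.exp (-lam * x.1) + Real.exp (-lam * y.1)) *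
            (|(x - y).1| * |(planeKer (x - y)).1|) := by ring
        _ ≤ _ := mul_le_of_le_one_right (mul_nonneg hlam hE) e3
    have e5 := mul_le_mul_of_nonneg_left ((neg_le_abs _).trans e4) hff
    simp only [hA, Prod.swap_prod_mk, hodd]
    linarith
  have hAs : Integrable (fun p => A p.swap) (volume.prod volume) := hAi.swap
  have h3 := integral_mono (μ := volume.prod volume) (hAi.add hAs).neg
    ((hB1.add hB2).const_mul lam) hpt
  simp only [Pi.neg_apply, Pi.add_apply] at h3
  rw [integral_neg, integral_add hAi hAs, integral_const_mul, integral_add hB1 hB2,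
    integral_prod_mul (fun x : ℝ × ℝ => Real.exp (-lam * x.1) * f x) f,
    integral_prod_mul f (fun x : ℝ × ℝ => Real.exp (-lam * x.1) * f x)] at h3
  rw [h2] at h3
  rw [h1]
  linarith

end planeVel

section decay

variable (hsol : IsEulerSol ω u)
include hsol

lemma nonneg_of_nonneg (hnonneg : ∀ x, 0 ≤ ω 0 x) {t : ℝ} (ht : 0 ≤ t) (x : ℝ × ℝ) :
    0 ≤ ω t x := by
  obtain ⟨R, hR⟩ := exists_vanishesOff_Icc hsol t
  have hg : ContDiff ℝ 1 fun s : ℝ => max (-s) 0 ^ 2 := contDiff_max_zero_sq.comp contDiff_neg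
  have h := integral_comp_eq hsol le_rfl ht hR hg (by simp)
  have h0 : ∫ x, max (-ω 0 x) 0 ^ 2 = 0 :=
    integral_eq_zero_of_ae (.of_forall fun x => by simp [hnonneg x])
  rw [h0] at h
  have h1 := eq_zero_of_integral_nonpos hsol (t := t) (p := fun _ => 1) continuous_const
    (fun _ => zero_le_one) hg.continuous (by simp) (fun s => sq_nonneg _)
    (by simp only [one_mul]; exact h.le) x
  rw [one_mul] at h1
  have h2 := pow_eq_zero_iff two_ne_zero |>.1 h1
  linarith [le_max_left (-ω t x) 0]

lemma mass_eq {t : ℝ} (ht : 0 ≤ t) : ∫ x, ω t x = ∫ x, ω 0 x := by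
  obtain ⟨R, hR⟩ := exists_vanishesOff_Icc hsol t
  exact integral_comp_eq hsol le_rfl ht hR contDiff_id rfl

lemma planeVel_reflection_fst_nonpos {t : ℝ} (hω : ∀ x, 0 ≤ ω t x) {x : ℝ × ℝ} (hx : 0 < x.2) :
    (planeVel (fun y => ω t (pbar y)) x).1 ≤ 0 := by
  rw [planeVel_fst (continuous_comp_pbar hsol t) (hasCompactSupport_comp_pbar hsol t)]
  refine integral_nonpos fun y => ?_
  rcases le_or_gt 0 y.2 with hy | hy
  · have : ω t (pbar y) = 0 := eq_zero_of_snd_nonpos hsol t (by simpa [pbar] using hy)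
    simp [this]
  · refine mul_nonpos_of_nonneg_of_nonpos (hω _) ?_
    rw [planeKer_fst, neg_nonpos]
    have : 0 ≤ (x - y).2 := by rw [Prod.snd_sub]; linarith
    positivity

lemma neg_integral_exp_velocity_le {t : ℝ} (hω : ∀ x, 0 ≤ ω t x) {lam : ℝ} (hlam : 0 ≤ lam) :
    -∫ x, Real.exp (-lam * x.1) * ω t x * (u t x).1 ≤
      lam * (∫ x, ω t x) * ∫ x, Real.exp (-lam * x.1) * ω t x := by
  have hf := continuous_slice hsol t
  have hc := hsol.compactSupp t
  refine le_trans ?_ (neg_integral_exp_planeVel_le hf hc hω hlam)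
  have hw : Continuous fun x : ℝ × ℝ => Real.exp (-lam * x.1) * ω t x := by fun_prop
  have hwc : HasCompactSupport fun x : ℝ × ℝ => Real.exp (-lam * x.1) * ω t x := hc.mul_left
  have hi1 : Integrable fun x => Real.exp (-lam * x.1) * ω t x * (u t x).1 :=
    integrable_clm_velocity hsol t
      (L := fun x => (Real.exp (-lam * x.1) * ω t x) • ContinuousLinearMap.fst ℝ ℝ ℝ)
      (hw.smul continuous_const) hwc.smul_right
  have hi2 : Integrable fun x => Real.exp (-lam * x.1) * ω t x * (planeVel (ω t) x).1 := by
    refine (integrable_prod_planeKer_fst hf hc hw hwc).integral_prod_left.congr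
      (.of_forall fun x => ?_)
    simp only
    rw [planeVel_fst hf hc, integral_const_mul]
  rw [neg_le_neg_iff]
  refine integral_mono hi2 hi1 fun x => ?_
  rcases le_or_gt x.2 0 with hx | hx
  · simp [eq_zero_of_snd_nonpos hsol t hx]
  · refine mul_le_mul_of_nonneg_left ?_ (mul_nonneg (Real.exp_pos _).le (hω x))
    have := planeVel_reflection_fst_nonpos hsol hω hx
    rw [velocity_eq hsol, Prod.fst_sub]
    linarith

lemma exp_moment_le (hnonneg : ∀ x, 0 ≤ ω 0 x) {lam t : ℝ} (hlam : 0 ≤ lam) (ht : 0 ≤ t) :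
    ∫ x, Real.exp (-lam * x.1 - lam ^ 2 * (∫ y, ω 0 y) * t) * ω t x ≤
      ∫ x, Real.exp (-lam * x.1) * ω 0 x := by
  obtain ⟨R, hR⟩ := exists_vanishesOff_Icc hsol t
  set κ := lam ^ 2 * ∫ y, ω 0 y with hκ
  have hφ : ContDiff ℝ 1 fun q : ℝ × (ℝ × ℝ) => Real.exp (-lam * q.2.1 - κ * q.1) := by fun_prop
  have hdφ : ∀ s x v, fderiv ℝ (fun q : ℝ × (ℝ × ℝ) => Real.exp (-lam * q.2.1 - κ * q.1))
      (s, x) (1, v) = Real.exp (-lam * x.1 - κ * s) * (-lam * v.1 - κ) := by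
    intro s x v
    have h1 : HasFDerivAt (fun q : ℝ × (ℝ × ℝ) => -lam * q.2.1 - κ * q.1)
        (-lam • ((ContinuousLinearMap.fst ℝ ℝ ℝ).comp (ContinuousLinearMap.snd ℝ ℝ (ℝ × ℝ))) -
          κ • ContinuousLinearMap.fst ℝ ℝ (ℝ × ℝ)) (s, x) :=
      (hasFDerivAt_snd.fst.const_mul (-lam)).sub (hasFDerivAt_fst.const_mul κ)
    rw [h1.exp.fderiv]
    simp
  have h := weighted_integral_le hsol le_rfl ht hR hφ contDiff_id rfl fun s hs => ?_
  · simpa using h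
  have hωs : ∀ x, 0 ≤ ω s x := nonneg_of_nonneg hsol hnonneg hs.1
  have hkey := neg_integral_exp_velocity_le hsol hωs hlam
  rw [mass_eq hsol hs.1] at hkey
  have hw : Continuous fun x : ℝ × ℝ => Real.exp (-lam * x.1) * ω s x := by
    have := continuous_slice hsol s
    fun_prop
  have hwc : HasCompactSupport fun x : ℝ × ℝ => Real.exp (-lam * x.1) * ω s x :=
    (hsol.compactSupp s).mul_left
  have hi1 : Integrable fun x => Real.exp (-lam * x.1) * ω s x * (u s x).1 :=
    integrable_clm_velocity hsol s
      (L := fun x => (Real.exp (-lam * x.1) * ω s x) • ContinuousLinearMap.fst ℝ ℝ ℝ)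
      (hw.smul continuous_const) hwc.smul_right
  have hi2 : Integrable fun x : ℝ × ℝ => Real.exp (-lam * x.1) * ω s x :=
    hw.integrable_of_hasCompactSupport hwc
  have heq : ∀ x, fderiv ℝ (fun q : ℝ × (ℝ × ℝ) => Real.exp (-lam * q.2.1 - κ * q.1))
      (s, x) (1, u s x) * id (ω s x) = Real.exp (-(κ * s)) *
        (-lam * (Real.exp (-lam * x.1) * ω s x * (u s x).1) -
          κ * (Real.exp (-lam * x.1) * ω s x)) := by
    intro x
    rw [hdφ, sub_eq_add_neg (-lam * x.1), Real.exp_add, id]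
    ring
  simp only [heq]
  rw [integral_const_mul, integral_sub (hi1.const_mul _) (hi2.const_mul _), integral_const_mul,
    integral_const_mul]
  refine mul_nonpos_of_nonneg_of_nonpos (Real.exp_pos _).le ?_
  have := mul_le_mul_of_nonneg_left hkey hlam
  rw [hκ]
  linarith

lemma backflow_mass_le (hnonneg : ∀ x, 0 ≤ ω 0 x) {R : ℝ} (hR : VanishesOff ω 0 R)
    {lam t : ℝ} (hlam : 0 ≤ lam) (ht : 0 ≤ t) (r : ℝ) :
    (∫ y in {y : ℝ × ℝ | y ∈ Hplane ∧ y.1 < -r}, ω t y) ≤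
      (∫ y, ω 0 y) * Real.exp (lam * (R - r) + lam ^ 2 * (∫ y, ω 0 y) * t) := by
  set m := ∫ y, ω 0 y with hm
  have hmom := exp_moment_le hsol hnonneg hlam ht
  rw [← hm] at hmom
  have hωt := nonneg_of_nonneg hsol hnonneg ht
  have hint : ∀ s, Integrable (ω s) := fun s =>
    (continuous_slice hsol s).integrable_of_hasCompactSupport (hsol.compactSupp s)
  have hinit : ∫ x, Real.exp (-lam * x.1) * ω 0 x ≤ Real.exp (lam * R) * m := by
    rw [hm, ← integral_const_mul]
    refine integral_mono ?_ ((hint 0).const_mul _) fun x => ?_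
    · have := continuous_slice hsol 0
      exact Continuous.integrable_of_hasCompactSupport (by fun_prop) (hsol.compactSupp 0).mul_left
    · rcases lt_or_ge R ‖x‖ with hx | hx
      · simp [hR x hx]
      · refine mul_le_mul_of_nonneg_right (Real.exp_le_exp.2 ?_) (hnonneg x)
        have h1 := neg_abs_le x.1
        have h2 : |x.1| ≤ R := (norm_fst_le x).trans hx
        nlinarith
  have hi : Integrable fun x : ℝ × ℝ =>
      Real.exp (-lam * r + lam ^ 2 * m * t) *
        (Real.exp (-lam * x.1 - lam ^ 2 * m * t) * ω t x) := by
    have := continuous_slice hsol t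
    exact Continuous.integrable_of_hasCompactSupport (by fun_prop)
      (hsol.compactSupp t).mul_left.mul_left
  have hmeas : MeasurableSet {y : ℝ × ℝ | y ∈ Hplane ∧ y.1 < -r} :=
    (measurableSet_lt measurable_const measurable_snd).inter
      (measurableSet_lt measurable_fst measurable_const)
  calc (∫ y in {y : ℝ × ℝ | y ∈ Hplane ∧ y.1 < -r}, ω t y)
      ≤ ∫ x in {y : ℝ × ℝ | y ∈ Hplane ∧ y.1 < -r}, Real.exp (-lam * r + lam ^ 2 * m * t) *
        (Real.exp (-lam * x.1 - lam ^ 2 * m * t) * ω t x) := by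
        refine setIntegral_mono_on (hint t).integrableOn hi.integrableOn hmeas fun x hx => ?_
        rw [← mul_assoc, ← Real.exp_add]
        refine le_mul_of_one_le_left (hωt x) (Real.one_le_exp ?_)
        have : x.1 < -r := hx.2
        nlinarith
    _ ≤ ∫ x, Real.exp (-lam * r + lam ^ 2 * m * t) *
        (Real.exp (-lam * x.1 - lam ^ 2 * m * t) * ω t x) :=
        setIntegral_le_integral hi (.of_forall fun x =>
          mul_nonneg (Real.exp_pos _).le (mul_nonneg (Real.exp_pos _).le (hωt x)))
    _ ≤ Real.exp (-lam * r + lam ^ 2 * m * t) * (Real.exp (lam * R) * m) := by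
        rw [integral_const_mul]
        exact mul_le_mul_of_nonneg_left (hmom.trans hinit) (Real.exp_pos _).le
    _ = m * Real.exp (lam * (R - r) + lam ^ 2 * m * t) := by
        rw [← mul_assoc, ← Real.exp_add, mul_comm]
        ring_nf

end decay

end HalfPlaneEuler

/-- Lemma 2.3: exponential smallness of the vorticity mass in the back-flow
region: for each `k` there are `D₁, D₂ > 0` depending only on `ω₀` and `k`
with `∫_{y₁ < -r} ω(t,y) dy ≤ D₁ / rᵏ` whenever `t ≥ 2` and
`r ≥ D₂ (t log t)^{1/2}`. -/
theorem stmt_3 (ω : ℝ → ℝ × ℝ → ℝ) (u : ℝ → ℝ × ℝ → ℝ × ℝ)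
    (hsol : IsEulerSol ω u) (hnonneg : ∀ x, 0 ≤ ω 0 x)
    (k : ℕ) :
    ∃ D₁ : ℝ, 0 < D₁ ∧ ∃ D₂ : ℝ, 0 < D₂ ∧
      ∀ t : ℝ, 2 ≤ t → ∀ r : ℝ, D₂ * Real.sqrt (t * Real.log t) ≤ r →
        (∫ y in {y : ℝ × ℝ | y ∈ Hplane ∧ y.1 < -r}, ω t y) ≤ D₁ / r ^ k := by
  obtain ⟨R₀, hR₀⟩ := HalfPlaneEuler.exists_vanishesOff hsol 0
  set R := max R₀ 0
  have hR : HalfPlaneEuler.VanishesOff ω 0 R := hR₀.mono (le_max_left _ _)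
  have hR0 : 0 ≤ R := le_max_right _ _
  set m := ∫ y, ω 0 y with hm
  have hm0 : 0 ≤ m := MeasureTheory.integral_nonneg hnonneg
  set D := 16 * (m + 1) * (k + 1) + 2 * R with hD
  have hk0 : (0 : ℝ) ≤ k := Nat.cast_nonneg k
  have hD16 : 16 * (m + 1) * k + 1 ≤ D := by nlinarith
  have hD2R : 2 * R ≤ D := by nlinarith
  have hD1 : 1 ≤ D := by nlinarith [mul_nonneg hm0 hk0]
  have hD0 : 0 < D := by linarith
  refine ⟨(m + 1) * D ^ k, by positivity, D, hD0, fun t ht r hr => ?_⟩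
  have ht0 : 0 < t := by linarith
  have hlog2 : 1 / 2 ≤ Real.log t := by
    have := Real.log_le_log two_pos ht
    linarith [Real.log_two_gt_d9]
  have htl : 1 ≤ t * Real.log t := by nlinarith
  have hsqrt : 1 ≤ Real.sqrt (t * Real.log t) := Real.one_le_sqrt.2 htl
  have hrD : D ≤ r := (le_mul_of_one_le_right hD0.le hsqrt).trans hr
  have hr0 : 0 < r := by linarith
  have hr2 : D ^ 2 * (t * Real.log t) ≤ r ^ 2 := by
    have := pow_le_pow_left₀ (by positivity) hr 2
    rwa [mul_pow, Real.sq_sqrt (by linarith)] at this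
  set s := r ^ 2 / t with hs
  have hst : r ^ 2 = s * t := by rw [hs]; field_simp
  have hs0 : 0 ≤ s := by positivity
  have htexp : t ≤ Real.exp (s / D ^ 2) := by
    rw [← Real.log_le_iff_le_exp ht0, le_div_iff₀ (by positivity), hs, le_div_iff₀ ht0]
    linarith
  have hrexp : r ≤ D * Real.exp (s / D ^ 2) := by
    refine (sq_le_sq₀ hr0.le (by positivity)).1 ?_
    have h1 : s / D ^ 2 ≤ Real.exp (s / D ^ 2) := by linarith [Real.add_one_le_exp (s / D ^ 2)]
    have h2 : s ≤ D ^ 2 * Real.exp (s / D ^ 2) := by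
      rwa [div_le_iff₀ (by positivity), mul_comm] at h1
    rw [hst, mul_pow, sq (Real.exp _), ← mul_assoc]
    exact mul_le_mul h2 htexp ht0.le (by positivity)
  have hrk : r ^ k ≤ D ^ k * Real.exp (s / (16 * (m + 1))) := by
    refine (pow_le_pow_left₀ hr0.le hrexp k).trans ?_
    rw [mul_pow, ← Real.exp_nat_mul]
    refine mul_le_mul_of_nonneg_left (Real.exp_le_exp.2 ?_) (by positivity)
    rw [← mul_div_assoc, div_le_div_iff₀ (by positivity) (by positivity)]
    have : 16 * (m + 1) * k ≤ D ^ 2 := by nlinarith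
    nlinarith
  have hmain := HalfPlaneEuler.backflow_mass_le hsol hnonneg hR
    (lam := r / (4 * (m + 1) * t)) (by positivity) ht0.le r
  rw [← hm] at hmain
  rw [le_div_iff₀ (by positivity)]
  have hexp : r / (4 * (m + 1) * t) * (R - r) + (r / (4 * (m + 1) * t)) ^ 2 * m * t ≤
      -(s / (16 * (m + 1))) := by
    have h1 : r / (4 * (m + 1) * t) * (R - r) ≤ r / (4 * (m + 1) * t) * (-(r / 2)) :=
      mul_le_mul_of_nonneg_left (by linarith) (by positivity)
    have h2 : (r / (4 * (m + 1) * t)) ^ 2 * m * t ≤ (r / (4 * (m + 1) * t)) ^ 2 * (m + 1) * t := by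
      gcongr
      linarith
    have h3 : r / (4 * (m + 1) * t) * (-(r / 2)) + (r / (4 * (m + 1) * t)) ^ 2 * (m + 1) * t =
        -(s / (16 * (m + 1))) := by
      rw [hs]
      field_simp
      ring
    linarith
  calc _ ≤ m * Real.exp (-(s / (16 * (m + 1)))) * (D ^ k * Real.exp (s / (16 * (m + 1)))) := by
        refine mul_le_mul (hmain.trans ?_) hrk (by positivity) (by positivity)
        exact mul_le_mul_of_nonneg_left (Real.exp_le_exp.2 hexp) hm0
    _ = m * D ^ k := by
        rw [Real.exp_neg]
        field_simp
    _ ≤ (m + 1) * D ^ k := by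
        gcongr
        linarith
end

section
/- Let (ω,u) be a smooth solution of the vorticity form of the 2D incompressible Euler equations on ℍ with nonnegative, compactly supported initial vorticity ω₀ = ω(0,·). Then there exists a positive constant D, depending only on ω₀, such that for all t > 2 the support of ω(t,·) is contained in {x ∈ ℍ : x₁ ≥ −D (t log t)^{1/2}}. -/
open MeasureTheory

open Filter Topology Set

lemma norm_sq_le_nrm_sq (z : ℝ × ℝ) : ‖z‖ ^ 2 ≤ nrm z ^ 2 := by
  rw [nrm, Real.sq_sqrt (by positivity), Prod.norm_def]
  rcases max_choice ‖z.1‖ ‖z.2‖ with h | h <;> rw [h, Real.norm_eq_abs, sq_abs] <;> nlinarith [sq_nonneg z.1, sq_nonneg z.2]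

lemma nrm_sq (z : ℝ × ℝ) : nrm z ^ 2 = z.1 ^ 2 + z.2 ^ 2 :=
  Real.sq_sqrt (by positivity)

lemma perp_zero : perp 0 = 0 := by simp [perp]

lemma norm_perp (z : ℝ × ℝ) : ‖perp z‖ = ‖z‖ := by
  simp [perp, Prod.norm_def, max_comm]

lemma norm_inv_smul_perp_le (z : ℝ × ℝ) :
    ‖(2 * Real.pi * nrm z ^ 2)⁻¹ • perp z‖ ≤ (1 / 2) * ‖z‖⁻¹ := by
  rcases eq_or_ne z 0 with rfl | hz
  · simp [perp]
  have hz' : 0 < ‖z‖ := norm_pos_iff.2 hz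
  have h1 := norm_sq_le_nrm_sq z
  rw [norm_smul, norm_perp, norm_inv, Real.norm_of_nonneg (by positivity)]
  have h2 : 2 * ‖z‖ ^ 2 ≤ 2 * Real.pi * nrm z ^ 2 := by
    have := Real.pi_gt_three
    nlinarith [sq_nonneg (nrm z)]
  calc (2 * Real.pi * nrm z ^ 2)⁻¹ * ‖z‖ ≤ (2 * ‖z‖ ^ 2)⁻¹ * ‖z‖ := by gcongr
    _ = (1 / 2) * ‖z‖⁻¹ := by field_simp

lemma norm_sub_le_norm_sub_pbar {x y : ℝ × ℝ} (hx : x ∈ Hplane) (hy : y ∈ Hplane) :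
    ‖x - y‖ ≤ ‖x - pbar y‖ := by
  have hx : 0 < x.2 := hx
  have hy : 0 < y.2 := hy
  simp only [pbar, Prod.norm_def, Prod.fst_sub, Prod.snd_sub, Real.norm_eq_abs]
  refine max_le_max le_rfl (abs_le_abs ?_ ?_) <;> linarith

lemma norm_Kker_le {x y : ℝ × ℝ} (hx : x ∈ Hplane) (hy : y ∈ Hplane) (hxy : y ≠ x) :
    ‖Kker x y‖ ≤ ‖x - y‖⁻¹ := by
  have h0 : 0 < ‖x - y‖ := norm_pos_iff.2 (sub_ne_zero.2 hxy.symm)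
  have h1 := norm_inv_smul_perp_le (x - y)
  have h2 := norm_inv_smul_perp_le (x - pbar y)
  have h3 : ‖x - pbar y‖⁻¹ ≤ ‖x - y‖⁻¹ := inv_anti₀ h0 (norm_sub_le_norm_sub_pbar hx hy)
  exact (norm_sub_le _ _).trans (by linarith)

lemma measurable_nrm : Measurable nrm := by unfold nrm; fun_prop
lemma measurable_perp : Measurable perp := by unfold perp; fun_prop
lemma measurable_pbar : Measurable pbar := by unfold pbar; fun_prop

lemma measurable_Kker : Measurable (fun q : (ℝ × ℝ) × (ℝ × ℝ) => Kker q.1 q.2) := by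
  have := measurable_nrm
  have := measurable_perp
  have := measurable_pbar
  unfold Kker
  fun_prop

/-- The truncation of `z ↦ ‖z‖⁻¹` to a ball. -/
noncomputable def truncInv (r : ℝ) (z : ℝ × ℝ) : ℝ := (Iio r).indicator (fun s => s⁻¹) ‖z‖

lemma integrable_truncInv (r : ℝ) : Integrable (truncInv r) := by
  unfold truncInv
  rw [integrable_fun_norm_addHaar volume (f := (Iio r).indicator (fun s => s⁻¹))]
  have : IntegrableOn ((Ioo 0 r).indicator (fun _ : ℝ => (1:ℝ))) (Ioi 0) :=
    ((integrable_indicator_iff measurableSet_Ioo).2 (by simp)).integrableOn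
  refine this.congr_fun (fun y hy => ?_) measurableSet_Ioi
  have hy : 0 < y := hy
  by_cases h : y < r <;> simp [indicator, h, hy, hy.ne']

lemma integral_truncInv {r : ℝ} (hr : 0 ≤ r) : ∫ z, truncInv r z = 8 * r := by
  unfold truncInv
  rw [integral_fun_norm_addHaar volume ((Iio r).indicator (fun s => s⁻¹))]
  have h : ∫ y in Ioi (0:ℝ), y ^ (Module.finrank ℝ (ℝ × ℝ) - 1) • (Iio r).indicator (fun s => s⁻¹) y
      = ∫ y in Ioi (0:ℝ), ((Ioo 0 r).indicator (fun _ : ℝ => (1:ℝ))) y := by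
    refine setIntegral_congr_fun measurableSet_Ioi (fun y hy => ?_)
    have hy : 0 < y := hy
    by_cases h : y < r <;> simp [indicator, h, hy, hy.ne']
  rw [h, setIntegral_indicator measurableSet_Ioo]
  have h2 : (volume : Measure (ℝ × ℝ)).real (Metric.ball 0 1) = 4 := by
    have : Metric.ball (0 : ℝ × ℝ) 1 = Metric.ball (0:ℝ) 1 ×ˢ Metric.ball (0:ℝ) 1 := by
      rw [ball_prod_same]; rfl
    rw [this, Measure.volume_eq_prod, measureReal_prod_prod]
    simp [Real.volume_real_ball]; norm_num
  rw [h2]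
  have : Ioi (0:ℝ) ∩ Ioo 0 r = Ioo 0 r := by ext; simp +contextual
  rw [this]
  simp [hr]; ring

lemma mul_inv_norm_le {f : ℝ × ℝ → ℝ} {S r : ℝ} (hr : 0 < r) (h0 : ∀ y, 0 ≤ f y)
    (hS : ∀ y, f y ≤ S) (x y : ℝ × ℝ) :
    f y * ‖x - y‖⁻¹ ≤ S * truncInv r (x - y) + f y * r⁻¹ := by
  unfold truncInv
  by_cases h : ‖x - y‖ < r
  · rw [indicator_of_mem (by exact h)]
    have := mul_le_mul_of_nonneg_right (hS y) (inv_nonneg.2 (norm_nonneg (x - y)))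
    have := mul_nonneg (h0 y) (inv_pos.2 hr).le
    linarith
  · rw [indicator_of_notMem (by exact h)]
    have := mul_le_mul_of_nonneg_left (inv_anti₀ hr (not_lt.1 h)) (h0 y)
    linarith

lemma integrable_mul_inv_norm {f : ℝ × ℝ → ℝ} (hf : Integrable f) {S : ℝ}
    (h0 : ∀ y, 0 ≤ f y) (hS : ∀ y, f y ≤ S) (x : ℝ × ℝ) :
    Integrable (fun y => f y * ‖x - y‖⁻¹) := by
  refine Integrable.mono' (g := fun y => S * truncInv 1 (x - y) + f y * 1⁻¹)
    ((((integrable_truncInv 1).comp_sub_left x).const_mul S).add (hf.mul_const _))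
    (hf.aestronglyMeasurable.mul (by fun_prop)) (ae_of_all _ fun y => ?_)
  rw [Real.norm_of_nonneg (mul_nonneg (h0 y) (by positivity))]
  exact mul_inv_norm_le one_pos h0 hS x y

lemma integral_mul_inv_norm_le {f : ℝ × ℝ → ℝ} (hf : Integrable f) {S r : ℝ} (hr : 0 < r)
    (h0 : ∀ y, 0 ≤ f y) (hS : ∀ y, f y ≤ S) (x : ℝ × ℝ) :
    ∫ y, f y * ‖x - y‖⁻¹ ≤ 8 * r * S + (∫ y, f y) / r := by
  have h1 := ((integrable_truncInv r).comp_sub_left x).const_mul S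
  have h2 := hf.mul_const r⁻¹
  calc _ ≤ ∫ y, (S * truncInv r (x - y) + f y * r⁻¹) :=
        integral_mono (integrable_mul_inv_norm hf h0 hS x) (h1.add h2)
          (mul_inv_norm_le hr h0 hS x)
    _ = _ := by
        rw [integral_add h1 h2, integral_const_mul, integral_sub_left_eq_self (truncInv r) _ x,
          integral_truncInv hr.le, integral_mul_const]
        ring

lemma integral_fderiv_regularized_perp {g : ℝ × ℝ → ℝ} (hg : ContDiff ℝ 1 g)
    (hc : HasCompactSupport g) {ε : ℝ} (hε : 0 < ε) :
    ∫ x, (nrm x ^ 2 + ε)⁻¹ * fderiv ℝ g x (perp x) = 0 := by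
  simp only [nrm_sq]
  have hpos : ∀ x : ℝ × ℝ, x.1 ^ 2 + x.2 ^ 2 + ε ≠ 0 := fun x => by positivity
  set w : ℝ × ℝ → ℝ := fun x => (x.1 ^ 2 + x.2 ^ 2 + ε)⁻¹ with hw
  have hwd : ContDiff ℝ 1 w := by
    apply ContDiff.inv _ hpos
    fun_prop
  have key : ∀ (a : ℝ × ℝ → ℝ) (v : ℝ × ℝ), ContDiff ℝ 1 a →
      Integrable (fun x => a x * fderiv ℝ g x v) ∧ Integrable (fun x => fderiv ℝ a x v * g x) ∧
      ∫ x, a x * fderiv ℝ g x v = -∫ x, fderiv ℝ a x v * g x := by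
    intro a v ha
    have i1 : Integrable (fun x => a x * fderiv ℝ g x v) := by
      apply Continuous.integrable_of_hasCompactSupport
      · exact ha.continuous.mul ((hg.continuous_fderiv one_ne_zero).clm_apply continuous_const)
      · exact (hc.fderiv_apply ℝ v).mul_left
    have i2 : Integrable (fun x => fderiv ℝ a x v * g x) := by
      apply Continuous.integrable_of_hasCompactSupport
      · exact ((ha.continuous_fderiv one_ne_zero).clm_apply continuous_const).mul hg.continuous
      · exact hc.mul_left
    refine ⟨i1, i2, integral_mul_fderiv_eq_neg_fderiv_mul_of_integrable i2 i1 ?_ ?_ ?_⟩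
    · exact (ha.continuous.mul hg.continuous).integrable_of_hasCompactSupport hc.mul_left
    · exact fun x _ => ha.differentiable one_ne_zero x
    · exact fun x _ => hg.differentiable one_ne_zero x
  obtain ⟨i1, j1, e1⟩ := key (fun x => x.2 * w x) (1, 0) (contDiff_snd.mul hwd)
  obtain ⟨i2, j2, e2⟩ := key (fun x => x.1 * w x) (0, 1) (contDiff_fst.mul hwd)
  have hsplit : ∀ x : ℝ × ℝ, w x * fderiv ℝ g x (perp x)
      = x.1 * w x * fderiv ℝ g x (0, 1) - x.2 * w x * fderiv ℝ g x (1, 0) := by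
    intro x
    have : perp x = x.1 • ((0, 1) : ℝ × ℝ) - x.2 • ((1, 0) : ℝ × ℝ) := by
      simp [perp]
    rw [this, map_sub, map_smul, map_smul, smul_eq_mul, smul_eq_mul]; ring
  have hder : ∀ x, fderiv ℝ (fun x => x.2 * w x) x (1, 0) = fderiv ℝ (fun x => x.1 * w x) x (0, 1) := by
    intro x
    rw [← (((contDiff_snd.mul hwd).differentiable one_ne_zero) x).lineDeriv_eq_fderiv,
      ← (((contDiff_fst.mul hwd).differentiable one_ne_zero) x).lineDeriv_eq_fderiv]
    simp only [lineDeriv, hw, Prod.fst_add, Prod.snd_add, Prod.smul_mk, smul_eq_mul, mul_zero,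
      mul_one, add_zero]
    have a1 : HasDerivAt (fun t : ℝ => ((x.1 + t) ^ 2 + x.2 ^ 2 + ε)) (2 * x.1) 0 := by
      simpa using ((((hasDerivAt_id (0:ℝ)).const_add x.1).pow 2).add_const (x.2 ^ 2)).add_const ε
    have a2 : HasDerivAt (fun t : ℝ => (x.1 ^ 2 + (x.2 + t) ^ 2 + ε)) (2 * x.2) 0 := by
      simpa using ((((hasDerivAt_id (0:ℝ)).const_add x.2).pow 2).const_add (x.1 ^ 2)).add_const ε
    have b1 := (a1.inv (by simpa using hpos x)).const_mul x.2
    have b2 := (a2.inv (by simpa using hpos x)).const_mul x.1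
    refine (b1.deriv.trans ?_).trans b2.deriv.symm
    simp; ring
  change ∫ x, w x * fderiv ℝ g x (perp x) = 0
  rw [integral_congr_ae (ae_of_all _ hsplit), integral_sub i2 i1, e1, e2]
  rw [integral_congr_ae (ae_of_all _ fun x => congrArg (· * g x) (hder x))]
  simp

lemma integrable_inv_norm_mul {h : ℝ × ℝ → ℝ} (hh : Continuous h) (hc : HasCompactSupport h) :
    Integrable (fun x => |h x| * ‖x‖⁻¹) := by
  obtain ⟨C, hC⟩ := hh.bounded_above_of_compact_support hc
  simpa using integrable_mul_inv_norm (f := fun x => |h x|)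
    ((hh.integrable_of_hasCompactSupport hc).abs) (fun _ => abs_nonneg _) hC 0

lemma integral_fderiv_perp {g : ℝ × ℝ → ℝ} (hg : ContDiff ℝ 1 g) (hc : HasCompactSupport g) :
    Integrable (fun x => fderiv ℝ g x ((2 * Real.pi * nrm x ^ 2)⁻¹ • perp x)) ∧
    ∫ x, fderiv ℝ g x ((2 * Real.pi * nrm x ^ 2)⁻¹ • perp x) = 0 := by
  have hgc := hg.continuous_fderiv one_ne_zero
  have hperp : Continuous perp := by unfold perp; fun_prop
  have hnrm : Continuous nrm := by unfold nrm; fun_prop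
  have hb : Integrable (fun x => |‖fderiv ℝ g x‖| * ‖x‖⁻¹) :=
    integrable_inv_norm_mul (h := fun x => ‖fderiv ℝ g x‖) hgc.norm (hc.fderiv ℝ).norm
  have hbound : ∀ ε : ℝ, 0 ≤ ε → ∀ x, ‖(nrm x ^ 2 + ε)⁻¹ * fderiv ℝ g x (perp x)‖
      ≤ |‖fderiv ℝ g x‖| * ‖x‖⁻¹ := by
    intro ε hε x
    rcases eq_or_ne x 0 with rfl | hx
    · simp [perp_zero]
    have hx' : 0 < ‖x‖ := norm_pos_iff.2 hx
    have h1 := norm_sq_le_nrm_sq x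
    rw [norm_mul, norm_inv, Real.norm_of_nonneg (by positivity), abs_norm]
    have h2 := (fderiv ℝ g x).le_opNorm (perp x)
    rw [norm_perp] at h2
    calc (nrm x ^ 2 + ε)⁻¹ * ‖fderiv ℝ g x (perp x)‖
        ≤ (‖x‖ ^ 2)⁻¹ * (‖fderiv ℝ g x‖ * ‖x‖) := by gcongr; linarith
      _ = _ := by field_simp
  have hmeas : ∀ ε : ℝ, AEStronglyMeasurable
      (fun x => (nrm x ^ 2 + ε)⁻¹ * fderiv ℝ g x (perp x)) volume := by
    intro ε
    refine AEStronglyMeasurable.mul ?_ (hgc.clm_apply hperp).aestronglyMeasurable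
    have := measurable_nrm
    exact Measurable.aestronglyMeasurable (by fun_prop)
  have hi : Integrable (fun x => (nrm x ^ 2)⁻¹ * fderiv ℝ g x (perp x)) := by
    have := Integrable.mono' hb (hmeas 0) (ae_of_all _ (hbound 0 le_rfl))
    simpa using this
  have heq : ∀ x, fderiv ℝ g x ((2 * Real.pi * nrm x ^ 2)⁻¹ • perp x)
      = (2 * Real.pi)⁻¹ * ((nrm x ^ 2)⁻¹ * fderiv ℝ g x (perp x)) := by
    intro x; rw [map_smul, smul_eq_mul, mul_inv, mul_assoc]
  simp_rw [heq]
  refine ⟨hi.const_mul _, ?_⟩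
  rw [integral_const_mul]
  have hlim : Tendsto (fun ε : ℝ => ∫ x, (nrm x ^ 2 + ε)⁻¹ * fderiv ℝ g x (perp x)) (𝓝[>] 0)
      (𝓝 (∫ x, (nrm x ^ 2)⁻¹ * fderiv ℝ g x (perp x))) := by
    refine tendsto_integral_filter_of_dominated_convergence _ (Eventually.of_forall hmeas)
      (eventually_nhdsWithin_of_forall fun ε hε => ae_of_all _ (hbound ε (le_of_lt hε))) hb
      (ae_of_all _ fun x => ?_)
    rcases eq_or_ne x 0 with rfl | hx
    · simp [perp_zero]
    have hx' : nrm x ^ 2 ≠ 0 := by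
      have : 0 < ‖x‖ ^ 2 := pow_pos (norm_pos_iff.2 hx) 2
      exact (this.trans_le (norm_sq_le_nrm_sq x)).ne'
    refine Tendsto.mul_const _ (tendsto_nhdsWithin_of_tendsto_nhds ?_)
    have : ContinuousAt (fun ε : ℝ => (nrm x ^ 2 + ε)⁻¹) 0 :=
      ContinuousAt.inv₀ (by fun_prop) (by simpa using hx')
    simpa [ContinuousAt] using this
  have hz : Tendsto (fun ε : ℝ => ∫ x, (nrm x ^ 2 + ε)⁻¹ * fderiv ℝ g x (perp x)) (𝓝[>] 0)
      (𝓝 0) := by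
    refine tendsto_const_nhds.congr' ?_
    filter_upwards [self_mem_nhdsWithin] with ε hε
    exact (integral_fderiv_regularized_perp hg hc hε).symm
  rw [tendsto_nhds_unique hlim hz, mul_zero]

lemma integral_fderiv_perp_sub {g : ℝ × ℝ → ℝ} (hg : ContDiff ℝ 1 g) (hc : HasCompactSupport g)
    (a : ℝ × ℝ) :
    Integrable (fun x => fderiv ℝ g x ((2 * Real.pi * nrm (x - a) ^ 2)⁻¹ • perp (x - a))) ∧
    ∫ x, fderiv ℝ g x ((2 * Real.pi * nrm (x - a) ^ 2)⁻¹ • perp (x - a)) = 0 := by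
  have hg' : ContDiff ℝ 1 (fun x => g (x + a)) := hg.comp (contDiff_id.add contDiff_const)
  have hc' : HasCompactSupport (fun x => g (x + a)) := hc.comp_homeomorph (Homeomorph.addRight a)
  obtain ⟨h1, h2⟩ := integral_fderiv_perp hg' hc'
  simp only [fderiv_comp_add_right] at h1 h2
  constructor
  · simpa using h1.comp_sub_right a
  · rw [← h2, ← integral_add_right_eq_self _ a]
    simp

lemma integral_fderiv_Kker {g : ℝ × ℝ → ℝ} (hg : ContDiff ℝ 1 g) (hc : HasCompactSupport g)
    (y : ℝ × ℝ) : ∫ x, fderiv ℝ g x (Kker x y) = 0 := by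
  obtain ⟨h1, h2⟩ := integral_fderiv_perp_sub hg hc y
  obtain ⟨h3, h4⟩ := integral_fderiv_perp_sub hg hc (pbar y)
  simp only [Kker, map_sub]
  rw [integral_sub h1 h3, h2, h4, sub_zero]

section EulerBasics

variable {ω : ℝ → ℝ × ℝ → ℝ} {u : ℝ → ℝ × ℝ → ℝ × ℝ}

namespace IsEulerSol

lemma eq_zero_of_notMem (h : IsEulerSol ω u) (t : ℝ) {x : ℝ × ℝ} (hx : x ∉ Hplane) : ω t x = 0 :=
  image_eq_zero_of_notMem_tsupport fun hx' => hx (h.suppIn t hx')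

lemma contDiff_joint (h : IsEulerSol ω u) : ContDiff ℝ 1 (fun q : ℝ × (ℝ × ℝ) => ω q.1 q.2) :=
  h.smooth.of_le (by exact_mod_cast le_top)

lemma contDiff_slice (h : IsEulerSol ω u) (t : ℝ) : ContDiff ℝ 1 (ω t) :=
  h.contDiff_joint.comp (contDiff_const.prodMk contDiff_id)

lemma continuous_slice (h : IsEulerSol ω u) (t : ℝ) : Continuous (ω t) :=
  (h.contDiff_slice t).continuous

lemma integrable_slice (h : IsEulerSol ω u) (t : ℝ) : Integrable (ω t) :=
  (h.continuous_slice t).integrable_of_hasCompactSupport (h.compactSupp t)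

lemma exists_abs_le (h : IsEulerSol ω u) (t : ℝ) : ∃ S, ∀ y, |ω t y| ≤ S :=
  (h.continuous_slice t).bounded_above_of_compact_support (h.compactSupp t)

lemma velocity_eq (h : IsEulerSol ω u) (t : ℝ) (x : ℝ × ℝ) :
    u t x = ∫ y, ω t y • Kker x y := by
  rw [h.biotSavart]
  refine setIntegral_eq_integral_of_forall_compl_eq_zero fun y hy => ?_
  rw [h.eq_zero_of_notMem t hy, zero_smul]

lemma integrable_abs_mul_inv_norm (h : IsEulerSol ω u) (t : ℝ) (x : ℝ × ℝ) :
    Integrable (fun y => |ω t y| * ‖x - y‖⁻¹) := by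
  obtain ⟨S, hS⟩ := h.exists_abs_le t
  exact integrable_mul_inv_norm (h.integrable_slice t).abs (fun _ => abs_nonneg _) hS x

lemma norm_smul_Kker_le (h : IsEulerSol ω u) (t : ℝ) {x : ℝ × ℝ} (hx : x ∈ Hplane) :
    ∀ᵐ y, ‖ω t y • Kker x y‖ ≤ |ω t y| * ‖x - y‖⁻¹ := by
  filter_upwards [Measure.ae_ne volume x] with y hy
  by_cases hyH : y ∈ Hplane
  · rw [norm_smul]
    exact mul_le_mul_of_nonneg_left (norm_Kker_le hx hyH hy) (abs_nonneg _)
  · simp [h.eq_zero_of_notMem t hyH]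

lemma integrable_smul_Kker (h : IsEulerSol ω u) (t : ℝ) {x : ℝ × ℝ} (hx : x ∈ Hplane) :
    Integrable (fun y => ω t y • Kker x y) := by
  refine Integrable.mono' (h.integrable_abs_mul_inv_norm t x) ?_ (h.norm_smul_Kker_le t hx)
  have h1 : Measurable (fun y => Kker x y) := Measurable.of_uncurry_left (f := Kker) measurable_Kker
  exact (h.continuous_slice t).aestronglyMeasurable.smul h1.aestronglyMeasurable

lemma norm_velocity_le (h : IsEulerSol ω u) (t : ℝ) {x : ℝ × ℝ} (hx : x ∈ Hplane) :
    ‖u t x‖ ≤ ∫ y, |ω t y| * ‖x - y‖⁻¹ := by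
  rw [h.velocity_eq]
  exact norm_integral_le_of_norm_le (h.integrable_abs_mul_inv_norm t x) (h.norm_smul_Kker_le t hx)

lemma norm_velocity_le_sup_add_mass (h : IsEulerSol ω u) {t S : ℝ} (hS : ∀ y, |ω t y| ≤ S)
    {x : ℝ × ℝ} (hx : x ∈ Hplane) : ‖u t x‖ ≤ 8 * S + ∫ y, |ω t y| := by
  refine (h.norm_velocity_le t hx).trans ?_
  simpa using integral_mul_inv_norm_le (h.integrable_slice t).abs one_pos
    (fun _ => abs_nonneg _) hS x

lemma measurable_velocity (h : IsEulerSol ω u) (t : ℝ) : StronglyMeasurable (u t) := by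
  have h1 : u t = fun x => ∫ y, ω t y • Kker x y := funext (h.velocity_eq t)
  rw [h1]
  have h2 : StronglyMeasurable (fun q : (ℝ × ℝ) × (ℝ × ℝ) => ω t q.2 • Kker q.1 q.2) :=
    (((h.continuous_slice t).measurable.comp measurable_snd).smul
      measurable_Kker).stronglyMeasurable
  exact h2.integral_prod_right

lemma integrable_clm_velocity (h : IsEulerSol ω u) (t : ℝ) {L : ℝ × ℝ → (ℝ × ℝ →L[ℝ] ℝ)}
    (hL : Continuous L) (hc : HasCompactSupport L) (h0 : ∀ x ∉ Hplane, L x = 0) :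
    Integrable (fun x => L x (u t x)) := by
  obtain ⟨S, hS⟩ := h.exists_abs_le t
  refine Integrable.mono' (g := fun x => ‖L x‖ * (8 * S + ∫ y, |ω t y|))
    ((hL.norm.integrable_of_hasCompactSupport hc.norm).mul_const _) ?_ (ae_of_all _ fun x => ?_)
  · have h1 : Continuous (fun q : (ℝ × ℝ →L[ℝ] ℝ) × (ℝ × ℝ) => q.1 q.2) := by fun_prop
    exact h1.comp_aestronglyMeasurable
      (hL.aestronglyMeasurable.prodMk (h.measurable_velocity t).aestronglyMeasurable)
  · by_cases hx : x ∈ Hplane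
    · refine ((L x).le_opNorm _).trans ?_
      exact mul_le_mul_of_nonneg_left (h.norm_velocity_le_sup_add_mass hS hx) (norm_nonneg _)
    · simp [h0 x hx]

lemma fderiv_eq_zero_of_notMem {g : ℝ × ℝ → ℝ} (hs : tsupport g ⊆ Hplane) {x : ℝ × ℝ}
    (hx : x ∉ Hplane) : fderiv ℝ g x = 0 :=
  image_eq_zero_of_notMem_tsupport fun h => hx (hs (tsupport_fderiv_subset ℝ h))

/-- Fubini for fields of functionals tested against the velocity. -/
lemma integral_clm_velocity (h : IsEulerSol ω u) (t : ℝ) {L : ℝ × ℝ → (ℝ × ℝ →L[ℝ] ℝ)}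
    (hL : Continuous L) (hc : HasCompactSupport L) (h0 : ∀ x ∉ Hplane, L x = 0) :
    Integrable (fun q : (ℝ × ℝ) × (ℝ × ℝ) => ω t q.2 * L q.1 (Kker q.1 q.2))
      (volume.prod volume) ∧
    ∫ x, L x (u t x) = ∫ x, ∫ y, ω t y * L x (Kker x y) := by
  obtain ⟨S, hS⟩ := h.exists_abs_le t
  set Ψ : (ℝ × ℝ) → (ℝ × ℝ) → ℝ := fun x y => ω t y * L x (Kker x y) with hΨ
  have hbound : ∀ x, ∀ᵐ y, ‖Ψ x y‖ ≤ ‖L x‖ * (|ω t y| * ‖x - y‖⁻¹) := by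
    intro x
    by_cases hx : x ∈ Hplane
    · filter_upwards [h.norm_smul_Kker_le t hx] with y hy
      have e : Ψ x y = L x (ω t y • Kker x y) := by simp [hΨ]
      rw [e]
      exact ((L x).le_opNorm _).trans (mul_le_mul_of_nonneg_left hy (norm_nonneg _))
    · simp [hΨ, h0 x hx]
  have hmeas : StronglyMeasurable (Function.uncurry Ψ) := by
    have h2 : Continuous (fun q : (ℝ × ℝ →L[ℝ] ℝ) × (ℝ × ℝ) => q.1 q.2) := by fun_prop
    refine StronglyMeasurable.mul
      ((h.continuous_slice t).comp continuous_snd).stronglyMeasurable ?_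
    exact h2.comp_stronglyMeasurable
      ((hL.comp continuous_fst).stronglyMeasurable.prodMk measurable_Kker.stronglyMeasurable)
  have hsec : ∀ x, Integrable (Ψ x) := fun x =>
    Integrable.mono' ((h.integrable_abs_mul_inv_norm t x).const_mul _)
      (hmeas.comp_measurable measurable_prodMk_left).aestronglyMeasurable (hbound x)
  constructor
  · change Integrable (Function.uncurry Ψ) (volume.prod volume)
    rw [integrable_prod_iff hmeas.aestronglyMeasurable]
    refine ⟨ae_of_all _ hsec, ?_⟩
    refine Integrable.mono' (g := fun x => ‖L x‖ * (8 * S + ∫ y, |ω t y|))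
      ((hL.norm.integrable_of_hasCompactSupport hc.norm).mul_const _)
      hmeas.norm.integral_prod_right.aestronglyMeasurable (ae_of_all _ fun x => ?_)
    rw [Real.norm_of_nonneg (integral_nonneg fun _ => norm_nonneg _)]
    have h3 := integral_mul_inv_norm_le (h.integrable_slice t).abs one_pos
      (fun _ => abs_nonneg _) hS x
    calc ∫ y, ‖Function.uncurry Ψ (x, y)‖
        ≤ ∫ y, ‖L x‖ * (|ω t y| * ‖x - y‖⁻¹) :=
          integral_mono_ae (hsec x).norm ((h.integrable_abs_mul_inv_norm t x).const_mul _)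
            (hbound x)
      _ ≤ _ := by
          rw [integral_const_mul]
          gcongr
          simpa using h3
  · refine integral_congr_ae (ae_of_all _ fun x => ?_)
    by_cases hx : x ∈ Hplane
    · simp only
      rw [h.velocity_eq, ← ContinuousLinearMap.integral_comp_comm _ (h.integrable_smul_Kker t hx)]
      simp
    · simp [h0 x hx]

lemma integral_fderiv_velocity (h : IsEulerSol ω u) (t : ℝ) {g : ℝ × ℝ → ℝ} (hg : ContDiff ℝ 1 g)
    (hc : HasCompactSupport g) (hs : tsupport g ⊆ Hplane) :
    ∫ x, fderiv ℝ g x (u t x) = 0 := by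
  obtain ⟨hint, heq⟩ := h.integral_clm_velocity t (hg.continuous_fderiv one_ne_zero)
    (hc.fderiv ℝ) (fun x hx => fderiv_eq_zero_of_notMem hs hx)
  rw [heq, integral_integral_swap hint]
  simp only [integral_const_mul, integral_fderiv_Kker hg hc, mul_zero, integral_zero]

lemma transport_univ (h : IsEulerSol ω u) {t : ℝ} (ht : 0 ≤ t) (x : ℝ × ℝ) :
    deriv (fun s => ω s x) t + fderiv ℝ (ω t) x (u t x) = 0 := by
  by_cases hx : x ∈ Hplane
  · exact h.transport t ht x hx
  · simp [fderiv_eq_zero_of_notMem (h.suppIn t) hx, h.eq_zero_of_notMem _ hx]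

/-- Evolution of `∫ φ β(ω)` over a time interval on which the supports of `ω` are uniformly
bounded. -/
lemma hasDerivAt_integral (h : IsEulerSol ω u) {a b K : ℝ} (ha : 0 ≤ a)
    (hK : ∀ t ∈ Icc a b, ∀ x, ω t x ≠ 0 → ‖x‖ ≤ K) {φ : ℝ → ℝ × ℝ → ℝ}
    (hφ : ContDiff ℝ 1 (fun q : ℝ × (ℝ × ℝ) => φ q.1 q.2)) {β : ℝ → ℝ} (hβ : ContDiff ℝ 1 β)
    (hβ0 : β 0 = 0) {t : ℝ} (ht : t ∈ Ioo a b) :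
    HasDerivAt (fun t => ∫ x, φ t x * β (ω t x))
      (∫ x, (deriv (fun s => φ s x) t + fderiv ℝ (φ t) x (u t x)) * β (ω t x)) t := by
  set G : ℝ × (ℝ × ℝ) → ℝ := fun q => φ q.1 q.2 * β (ω q.1 q.2) with hG
  have hGd : ContDiff ℝ 1 G := hφ.mul (hβ.comp h.contDiff_joint)
  have hline : ∀ (t : ℝ) (x : ℝ × ℝ), HasDerivAt (fun s => (s, x)) ((1 : ℝ), (0 : ℝ × ℝ)) t :=
    fun t x => (hasDerivAt_id t).prodMk (hasDerivAt_const t x)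
  have hd : ∀ t x, HasDerivAt (fun s => G (s, x)) (fderiv ℝ G (t, x) (1, 0)) t := fun t x =>
    HasFDerivAt.comp_hasDerivAt (l := G) (f := fun s => (s, x)) t
      (hGd.differentiable one_ne_zero (t, x)).hasFDerivAt (hline t x)
  have hFc : Continuous (fun q => fderiv ℝ G q (1, 0)) :=
    (hGd.continuous_fderiv one_ne_zero).clm_apply continuous_const
  have hzero : ∀ t ∈ Ioo a b, ∀ x, x ∉ Metric.closedBall (0 : ℝ × ℝ) K →
      fderiv ℝ G (t, x) (1, 0) = 0 := by
    intro t ht x hx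
    have : (fun s => G (s, x)) =ᶠ[𝓝 t] fun _ => 0 := by
      filter_upwards [Ioo_mem_nhds ht.1 ht.2] with s hs
      have : ω s x = 0 := by
        by_contra hne
        exact hx (by simpa using hK s ⟨hs.1.le, hs.2.le⟩ x hne)
      simp [hG, this, hβ0]
    exact (hd t x).unique ((hasDerivAt_const t (0:ℝ)).congr_of_eventuallyEq this)
  obtain ⟨C, hC⟩ := (isCompact_Icc.prod (isCompact_closedBall (0 : ℝ × ℝ) K)).exists_bound_of_continuousOn
    (s := Icc a b ×ˢ Metric.closedBall (0 : ℝ × ℝ) K) hFc.continuousOn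
  have hslice : ∀ t, Continuous (fun x => G (t, x)) := fun t =>
    hGd.continuous.comp (Continuous.prodMk_right t)
  have hgd : ContDiff ℝ 1 (fun x => G (t, x)) := hGd.comp (contDiff_const.prodMk contDiff_id)
  have hsub : tsupport (fun x => G (t, x)) ⊆ tsupport (ω t) := by
    refine closure_mono fun x hx => ?_
    contrapose! hx
    simp only [Function.mem_support, not_not] at hx ⊢
    simp [hG, hx, hβ0]
  have hcs : HasCompactSupport (fun x => G (t, x)) :=
    (h.compactSupp t).of_isClosed_subset (isClosed_tsupport _) hsub
  have key := hasDerivAt_integral_of_dominated_loc_of_deriv_le (μ := volume)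
    (F := fun t x => G (t, x)) (F' := fun t x => fderiv ℝ G (t, x) (1, 0)) (x₀ := t)
    (bound := (Metric.closedBall (0 : ℝ × ℝ) K).indicator fun _ => C)
    (Ioo_mem_nhds ht.1 ht.2)
    (Eventually.of_forall fun s => (hslice s).aestronglyMeasurable)
    ((hslice t).integrable_of_hasCompactSupport hcs)
    (hFc.comp (Continuous.prodMk_right t)).aestronglyMeasurable
    (ae_of_all _ fun x s hs => by
      by_cases hx : x ∈ Metric.closedBall (0 : ℝ × ℝ) K
      · rw [indicator_of_mem hx]
        exact hC (s, x) ⟨⟨hs.1.le, hs.2.le⟩, hx⟩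
      · rw [indicator_of_notMem hx, hzero s hs x hx, norm_zero])
    ((integrable_indicator_iff measurableSet_closedBall).2
      (integrableOn_const (isCompact_closedBall _ _).measure_lt_top.ne))
    (ae_of_all _ fun x s _ => hd s x)
  refine key.2.congr_deriv ?_
  have hφt : ContDiff ℝ 1 (φ t) := hφ.comp (contDiff_const.prodMk contDiff_id)
  have hpt : ∀ x, fderiv ℝ G (t, x) (1, 0)
      = (deriv (fun s => φ s x) t + fderiv ℝ (φ t) x (u t x)) * β (ω t x)
        - fderiv ℝ (fun x => G (t, x)) x (u t x) := by
    intro x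
    have e1 : HasDerivAt (fun s => φ s x) (deriv (fun s => φ s x) t) t := by
      have : DifferentiableAt ℝ (fun s => φ s x) t :=
        DifferentiableAt.comp (g := fun q : ℝ × (ℝ × ℝ) => φ q.1 q.2) (f := fun s => (s, x)) t
          (hφ.differentiable one_ne_zero (t, x)) (hline t x).differentiableAt
      exact this.hasDerivAt
    have e2 : HasDerivAt (fun s => ω s x) (deriv (fun s => ω s x) t) t := by
      have : DifferentiableAt ℝ (fun s => ω s x) t :=
        DifferentiableAt.comp (g := fun q : ℝ × (ℝ × ℝ) => ω q.1 q.2) (f := fun s => (s, x)) t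
          (h.contDiff_joint.differentiable one_ne_zero (t, x)) (hline t x).differentiableAt
      exact this.hasDerivAt
    have e3 : HasDerivAt β (deriv β (ω t x)) (ω t x) :=
      (hβ.differentiable one_ne_zero _).hasDerivAt
    have e4 := e1.mul (e3.comp t e2)
    have e5 : HasFDerivAt (φ t) (fderiv ℝ (φ t) x) x :=
      (hφt.differentiable one_ne_zero x).hasFDerivAt
    have e6 : HasFDerivAt (ω t) (fderiv ℝ (ω t) x) x :=
      ((h.contDiff_slice t).differentiable one_ne_zero x).hasFDerivAt
    have e7 := e5.mul (e3.comp_hasFDerivAt x e6)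
    have e8 := h.transport_univ (ha.trans ht.1.le) x
    rw [(hd t x).unique e4, (show HasFDerivAt (fun x => G (t, x)) _ x from e7).fderiv]
    simp only [Function.comp, add_apply, smul_apply,
      smul_eq_mul]
    rw [eq_neg_of_add_eq_zero_left e8]
    ring
  have i2 : Integrable (fun x => fderiv ℝ (fun x => G (t, x)) x (u t x)) :=
    h.integrable_clm_velocity t (hgd.continuous_fderiv one_ne_zero) (hcs.fderiv ℝ)
      (fun x hx => fderiv_eq_zero_of_notMem (hsub.trans (h.suppIn t)) hx)
  have i1 : Integrable (fun x =>
      (deriv (fun s => φ s x) t + fderiv ℝ (φ t) x (u t x)) * β (ω t x)) := by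
    refine (key.1.add i2).congr (ae_of_all _ fun x => ?_)
    simp only [Pi.add_apply]
    rw [hpt x]; ring
  rw [integral_congr_ae (ae_of_all _ hpt), integral_sub i1 i2,
    h.integral_fderiv_velocity t hgd hcs (hsub.trans (h.suppIn t)), sub_zero]

lemma continuousOn_integral (h : IsEulerSol ω u) {a b K : ℝ}
    (hK : ∀ t ∈ Icc a b, ∀ x, ω t x ≠ 0 → ‖x‖ ≤ K) {φ : ℝ → ℝ × ℝ → ℝ}
    (hφ : Continuous (fun q : ℝ × (ℝ × ℝ) => φ q.1 q.2)) {β : ℝ → ℝ} (hβ : Continuous β)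
    (hβ0 : β 0 = 0) :
    ContinuousOn (fun t => ∫ x, φ t x * β (ω t x)) (Icc a b) := by
  refine continuousOn_integral_of_compact_support (f := fun t x => φ t x * β (ω t x))
    (isCompact_closedBall (0 : ℝ × ℝ) K)
    (hφ.mul (hβ.comp h.contDiff_joint.continuous)).continuousOn fun t x ht hx => ?_
  have : ω t x = 0 := by
    by_contra hne
    exact hx (by simpa using hK t ht x hne)
  simp [this, hβ0]

end IsEulerSol

end EulerBasics

lemma Continuous.eq_zero_of_integral_eq_zero {f : ℝ × ℝ → ℝ} (hf : Continuous f)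
    (hc : HasCompactSupport f) (h0 : ∀ x, 0 ≤ f x) (hi : ∫ x, f x ≤ 0) (x : ℝ × ℝ) : f x = 0 := by
  by_contra hx
  exact hi.not_gt (hf.integral_pos_of_hasCompactSupport_nonneg_nonzero hc h0 hx)

lemma deriv_expNegInvGlue_of_neg {s : ℝ} (hs : s < 0) : deriv expNegInvGlue s = 0 := by
  have : expNegInvGlue =ᶠ[𝓝 s] fun _ => 0 := by
    filter_upwards [Iio_mem_nhds hs] with y hy
    exact expNegInvGlue.zero_of_nonpos (le_of_lt hy)
  rw [this.deriv_eq, deriv_const]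

section Confinement

variable {ω : ℝ → ℝ × ℝ → ℝ} {u : ℝ → ℝ × ℝ → ℝ × ℝ}

namespace IsEulerSol

lemma hasCompactSupport_mul_comp (h : IsEulerSol ω u) (t : ℝ) (g : ℝ × ℝ → ℝ) {β : ℝ → ℝ}
    (hβ0 : β 0 = 0) : HasCompactSupport (fun x => g x * β (ω t x)) :=
  ((h.compactSupp t).comp_left hβ0).mul_left

lemma integral_comp_eq (h : IsEulerSol ω u) {a b K : ℝ} (ha : 0 ≤ a)
    (hK : ∀ t ∈ Icc a b, ∀ x, ω t x ≠ 0 → ‖x‖ ≤ K) {β : ℝ → ℝ} (hβ : ContDiff ℝ 1 β)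
    (hβ0 : β 0 = 0) {s t : ℝ} (hs : s ∈ Icc a b) (ht : t ∈ Icc a b) :
    ∫ x, β (ω t x) = ∫ x, β (ω s x) := by
  have hd : ∀ t ∈ Ioo a b, HasDerivAt (fun t => ∫ x, β (ω t x)) 0 t := by
    intro t ht
    have := h.hasDerivAt_integral ha hK (φ := fun _ _ => 1) contDiff_const hβ hβ0 ht
    simpa using this
  have hc : ContinuousOn (fun t => ∫ x, β (ω t x)) (Icc a b) := by
    simpa using h.continuousOn_integral hK (φ := fun _ _ => 1) continuous_const hβ.continuous hβ0
  have hdi : DifferentiableOn ℝ (fun t => ∫ x, β (ω t x)) (interior (Icc a b)) := by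
    rw [interior_Icc]
    exact fun t ht => (hd t ht).differentiableAt.differentiableWithinAt
  have hm := monotoneOn_of_deriv_nonneg (convex_Icc a b) hc hdi
    (by rw [interior_Icc]; exact fun t ht => (hd t ht).deriv.ge)
  have hn := antitoneOn_of_deriv_nonpos (convex_Icc a b) hc hdi
    (by rw [interior_Icc]; exact fun t ht => (hd t ht).deriv.le)
  rcases le_total s t with hst | hst
  · exact le_antisymm (hn hs ht hst) (hm hs ht hst)
  · exact le_antisymm (hm ht hs hst) (hn ht hs hst)

lemma comp_eq_zero_of_comp_eq_zero (h : IsEulerSol ω u) {a b K : ℝ} (ha : 0 ≤ a)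
    (hK : ∀ t ∈ Icc a b, ∀ x, ω t x ≠ 0 → ‖x‖ ≤ K) {β : ℝ → ℝ} (hβ : ContDiff ℝ 1 β)
    (hβ0 : β 0 = 0) (hβn : ∀ z, 0 ≤ β z) {s t : ℝ} (hs : s ∈ Icc a b) (ht : t ∈ Icc a b)
    (h0 : ∀ x, β (ω s x) = 0) (x : ℝ × ℝ) : β (ω t x) = 0 := by
  have h1 := h.integral_comp_eq ha hK hβ hβ0 hs ht
  simp only [h0, integral_zero] at h1
  exact (hβ.continuous.comp (h.continuous_slice t)).eq_zero_of_integral_eq_zero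
    ((h.compactSupp t).comp_left hβ0) (fun _ => hβn _) h1.le x

lemma abs_le_of_abs_le (h : IsEulerSol ω u) {a b K : ℝ} (ha : 0 ≤ a)
    (hK : ∀ t ∈ Icc a b, ∀ x, ω t x ≠ 0 → ‖x‖ ≤ K) {s t : ℝ} (hs : s ∈ Icc a b)
    (ht : t ∈ Icc a b) {S : ℝ} (hS : ∀ x, |ω s x| ≤ S) (x : ℝ × ℝ) : |ω t x| ≤ S := by
  have hS0 : 0 ≤ S := (abs_nonneg _).trans (hS 0)
  have h1 := h.comp_eq_zero_of_comp_eq_zero ha hK (β := fun z => expNegInvGlue (z ^ 2 - S ^ 2))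
    (expNegInvGlue.contDiff.comp (by fun_prop))
    (expNegInvGlue.zero_of_nonpos (by nlinarith)) (fun _ => expNegInvGlue.nonneg _) hs ht
    (fun x => expNegInvGlue.zero_of_nonpos (by
      have := sq_le_sq₀ (abs_nonneg _) hS0 |>.2 (hS x)
      rw [sq_abs] at this; linarith)) x
  rw [expNegInvGlue.zero_iff_nonpos] at h1
  exact abs_le_of_sq_le_sq (by linarith) hS0

lemma nonneg_of_nonneg (h : IsEulerSol ω u) {a b K : ℝ} (ha : 0 ≤ a)
    (hK : ∀ t ∈ Icc a b, ∀ x, ω t x ≠ 0 → ‖x‖ ≤ K) {s t : ℝ} (hs : s ∈ Icc a b)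
    (ht : t ∈ Icc a b) (hS : ∀ x, 0 ≤ ω s x) (x : ℝ × ℝ) : 0 ≤ ω t x := by
  have h1 := h.comp_eq_zero_of_comp_eq_zero ha hK (β := fun z => expNegInvGlue (-z))
    (expNegInvGlue.contDiff.comp (by fun_prop))
    (expNegInvGlue.zero_of_nonpos (by simp)) (fun _ => expNegInvGlue.nonneg _) hs ht
    (fun x => expNegInvGlue.zero_of_nonpos (by simpa using hS x)) x
  rw [expNegInvGlue.zero_iff_nonpos] at h1
  linarith

lemma integral_abs_le (h : IsEulerSol ω u) {a b K : ℝ} (ha : 0 ≤ a)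
    (hK : ∀ t ∈ Icc a b, ∀ x, ω t x ≠ 0 → ‖x‖ ≤ K) {s t : ℝ} (hs : s ∈ Icc a b)
    (ht : t ∈ Icc a b) : ∫ x, |ω t x| ≤ ∫ x, |ω s x| := by
  set B := Metric.closedBall (0 : ℝ × ℝ) K with hB
  have key : ∀ ε : ℝ, 0 < ε → ∫ x, |ω t x| ≤ (∫ x, |ω s x|) + ε * volume.real B := by
    intro ε hε
    set β : ℝ → ℝ := fun z => Real.sqrt (z ^ 2 + ε ^ 2) - ε with hβdef
    have hβ : ContDiff ℝ 1 β :=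
      (ContDiff.sqrt (by fun_prop) (fun z => by positivity)).sub contDiff_const
    have hβ0 : β 0 = 0 := by simp [hβdef, Real.sqrt_sq hε.le]
    have hle : ∀ z, β z ≤ |z| := fun z => by
      have : Real.sqrt (z ^ 2 + ε ^ 2) ≤ |z| + ε := by
        rw [Real.sqrt_le_left (by positivity), ← sq_abs z]
        nlinarith [abs_nonneg z]
      simp only [hβdef]; linarith
    have hge : ∀ z, |z| ≤ β z + ε := fun z => by
      simp only [hβdef, sub_add_cancel]
      exact Real.abs_le_sqrt (by nlinarith)
    have hint : ∀ t, Integrable (fun x => β (ω t x)) := fun t =>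
      (hβ.continuous.comp (h.continuous_slice t)).integrable_of_hasCompactSupport
        ((h.compactSupp t).comp_left hβ0)
    have hind : Integrable (B.indicator fun _ : ℝ × ℝ => ε) :=
      (integrable_indicator_iff measurableSet_closedBall).2
        (integrableOn_const (isCompact_closedBall _ _).measure_lt_top.ne)
    calc ∫ x, |ω t x| ≤ ∫ x, (β (ω t x) + B.indicator (fun _ => ε) x) := by
          refine integral_mono (h.integrable_slice t).abs ((hint t).add hind) fun x => ?_
          by_cases hx : x ∈ B
          · simp only [indicator_of_mem hx]
            exact hge _
          · have : ω t x = 0 := by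
              by_contra hne
              exact hx (by simpa [hB] using hK t ht x hne)
            simp [indicator_of_notMem hx, this, hβ0]
      _ = (∫ x, β (ω s x)) + ε * volume.real B := by
          rw [integral_add (hint t) hind, h.integral_comp_eq ha hK hβ hβ0 hs ht,
            integral_indicator measurableSet_closedBall]
          simp [hB, mul_comm]
      _ ≤ _ := by
          have : ∫ x, β (ω s x) ≤ ∫ x, |ω s x| :=
            integral_mono (hint s) (h.integrable_slice s).abs fun x => hle _
          linarith
  refine le_of_forall_pos_le_add fun δ hδ => ?_
  have hV : 0 ≤ volume.real B := measureReal_nonneg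
  refine (key (δ / (volume.real B + 1)) (by positivity)).trans ?_
  gcongr
  rw [div_mul_eq_mul_div, div_le_iff₀ (by positivity)]
  nlinarith

/-- The weight `(t, x) ↦ ψ (ℓ x - ρ t)` tested against `ω²`. -/
lemma barrier_derivative (h : IsEulerSol ω u) {a b K : ℝ} (ha : 0 ≤ a)
    (hK : ∀ t ∈ Icc a b, ∀ x, ω t x ≠ 0 → ‖x‖ ≤ K) (l : ℝ × ℝ →L[ℝ] ℝ) {ρ : ℝ → ℝ}
    (hρ : ContDiff ℝ 1 ρ) :
    ContinuousOn (fun t => ∫ x, expNegInvGlue (l x - ρ t) * ω t x ^ 2) (Icc a b) ∧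
    ∀ t ∈ Ioo a b, HasDerivAt (fun t => ∫ x, expNegInvGlue (l x - ρ t) * ω t x ^ 2)
      (∫ x, deriv expNegInvGlue (l x - ρ t) * (l (u t x) - deriv ρ t) * ω t x ^ 2) t := by
  have hφ : ContDiff ℝ 1 (fun q : ℝ × (ℝ × ℝ) => expNegInvGlue (l q.2 - ρ q.1)) :=
    expNegInvGlue.contDiff.comp ((l.contDiff.comp contDiff_snd).sub (hρ.comp contDiff_fst))
  have hE : ∀ s, HasDerivAt expNegInvGlue (deriv expNegInvGlue s) s := fun s =>
    ((expNegInvGlue.contDiff (n := 1)).differentiable one_ne_zero s).hasDerivAt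
  refine ⟨h.continuousOn_integral hK (φ := fun t x => expNegInvGlue (l x - ρ t)) hφ.continuous
    (β := fun z => z ^ 2) (by fun_prop) (by simp), fun t ht => ?_⟩
  refine (h.hasDerivAt_integral ha hK (φ := fun t x => expNegInvGlue (l x - ρ t)) hφ
    (β := fun z => z ^ 2) (by fun_prop) (by simp) ht).congr_deriv ?_
  refine integral_congr_ae (ae_of_all _ fun x => ?_)
  have d1 : HasDerivAt (fun s => expNegInvGlue (l x - ρ s))
      (deriv expNegInvGlue (l x - ρ t) * (-deriv ρ t)) t :=
    (hE _).comp t ((hρ.differentiable one_ne_zero t).hasDerivAt.const_sub (l x))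
  have d2 : HasFDerivAt (fun x => expNegInvGlue (l x - ρ t))
      (deriv expNegInvGlue (l x - ρ t) • l) x :=
    (hE _).comp_hasFDerivAt x (l.hasFDerivAt.sub_const (ρ t))
  simp only [d1.deriv, d2.fderiv, smul_apply, smul_eq_mul]
  ring

lemma le_of_barrier_integral_nonpos (h : IsEulerSol ω u) (l : ℝ × ℝ →L[ℝ] ℝ) (r t : ℝ)
    (hi : ∫ x, expNegInvGlue (l x - r) * ω t x ^ 2 ≤ 0) {x : ℝ × ℝ} (hx : ω t x ≠ 0) :
    l x ≤ r := by
  have hc : Continuous (fun x => expNegInvGlue (l x - r) * ω t x ^ 2) :=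
    ((expNegInvGlue.contDiff (n := 0)).continuous.comp (by fun_prop)).mul
      ((h.continuous_slice t).pow 2)
  have := hc.eq_zero_of_integral_eq_zero
    (h.hasCompactSupport_mul_comp t _ (β := fun z => z ^ 2) (by simp))
    (fun x => mul_nonneg (expNegInvGlue.nonneg _) (sq_nonneg _)) hi x
  rcases mul_eq_zero.1 this with h1 | h1
  · rw [expNegInvGlue.zero_iff_nonpos] at h1; linarith
  · exact absurd (pow_eq_zero_iff two_ne_zero |>.1 h1) hx

lemma barrier_integral_eq_zero (l : ℝ × ℝ →L[ℝ] ℝ) {r t : ℝ}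
    (h0 : ∀ x, ω t x ≠ 0 → l x ≤ r) : ∫ x, expNegInvGlue (l x - r) * ω t x ^ 2 = 0 := by
  refine integral_eq_zero_of_ae (ae_of_all _ fun x => ?_)
  by_cases hx : ω t x = 0
  · simp [hx]
  · simp [expNegInvGlue.zero_of_nonpos (sub_nonpos.2 (h0 x hx))]

lemma barrier_forward (h : IsEulerSol ω u) {a b K : ℝ} (ha : 0 ≤ a)
    (hK : ∀ t ∈ Icc a b, ∀ x, ω t x ≠ 0 → ‖x‖ ≤ K) (l : ℝ × ℝ →L[ℝ] ℝ) {ρ : ℝ → ℝ}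
    (hρ : ContDiff ℝ 1 ρ)
    (hu : ∀ t ∈ Ioo a b, ∀ x ∈ Hplane, ρ t ≤ l x → l (u t x) ≤ deriv ρ t)
    (h0 : ∀ x, ω a x ≠ 0 → l x ≤ ρ a) {t : ℝ} (ht : t ∈ Icc a b) {x : ℝ × ℝ} (hx : ω t x ≠ 0) :
    l x ≤ ρ t := by
  obtain ⟨hc, hd⟩ := h.barrier_derivative ha hK l hρ
  have hanti := antitoneOn_of_deriv_nonpos (convex_Icc a b) hc
    (by rw [interior_Icc]; exact fun t ht => (hd t ht).differentiableAt.differentiableWithinAt)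
    (by
      rw [interior_Icc]
      intro t ht
      rw [(hd t ht).deriv]
      refine integral_nonpos fun x => ?_
      by_cases hxH : x ∈ Hplane
      · refine mul_nonpos_of_nonpos_of_nonneg ?_ (sq_nonneg _)
        rcases lt_or_ge (l x - ρ t) 0 with hlt | hge
        · simp [deriv_expNegInvGlue_of_neg hlt]
        · exact mul_nonpos_of_nonneg_of_nonpos expNegInvGlue.monotone.deriv_nonneg
            (sub_nonpos.2 (hu t ht x hxH (by linarith)))
      · simp [h.eq_zero_of_notMem t hxH])
  have ha' : a ∈ Icc a b := ⟨le_rfl, ht.1.trans ht.2⟩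
  exact h.le_of_barrier_integral_nonpos l _ t
    ((hanti ha' ht ht.1).trans (barrier_integral_eq_zero l h0).le) hx

lemma barrier_backward (h : IsEulerSol ω u) {a b K : ℝ} (ha : 0 ≤ a)
    (hK : ∀ t ∈ Icc a b, ∀ x, ω t x ≠ 0 → ‖x‖ ≤ K) (l : ℝ × ℝ →L[ℝ] ℝ) {ρ : ℝ → ℝ}
    (hρ : ContDiff ℝ 1 ρ)
    (hu : ∀ t ∈ Ioo a b, ∀ x ∈ Hplane, ρ t ≤ l x → deriv ρ t ≤ l (u t x))
    (h0 : ∀ x, ω b x ≠ 0 → l x ≤ ρ b) {t : ℝ} (ht : t ∈ Icc a b) {x : ℝ × ℝ} (hx : ω t x ≠ 0) :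
    l x ≤ ρ t := by
  obtain ⟨hc, hd⟩ := h.barrier_derivative ha hK l hρ
  have hmono := monotoneOn_of_deriv_nonneg (convex_Icc a b) hc
    (by rw [interior_Icc]; exact fun t ht => (hd t ht).differentiableAt.differentiableWithinAt)
    (by
      rw [interior_Icc]
      intro t ht
      rw [(hd t ht).deriv]
      refine integral_nonneg fun x => ?_
      by_cases hxH : x ∈ Hplane
      · refine mul_nonneg ?_ (sq_nonneg _)
        rcases lt_or_ge (l x - ρ t) 0 with hlt | hge
        · simp [deriv_expNegInvGlue_of_neg hlt]
        · exact mul_nonneg expNegInvGlue.monotone.deriv_nonneg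
            (sub_nonneg.2 (hu t ht x hxH (by linarith)))
      · simp [h.eq_zero_of_notMem t hxH])
  have hb' : b ∈ Icc a b := ⟨ht.1.trans ht.2, le_rfl⟩
  exact h.le_of_barrier_integral_nonpos l _ t
    ((hmono ht hb' ht.2).trans (barrier_integral_eq_zero l h0).le) hx

/-- Finite speed of propagation, forwards and backwards in time. -/
lemma norm_le_of_norm_le (h : IsEulerSol ω u) {a b K : ℝ} (ha : 0 ≤ a)
    (hK : ∀ t ∈ Icc a b, ∀ x, ω t x ≠ 0 → ‖x‖ ≤ K) {s t : ℝ} (hs : s ∈ Icc a b)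
    (ht : t ∈ Icc a b) {S k : ℝ} (hS : ∀ x, |ω s x| ≤ S) (hk : ∀ x, ω s x ≠ 0 → ‖x‖ ≤ k)
    {x : ℝ × ℝ} (hx : ω t x ≠ 0) :
    ‖x‖ ≤ k + (8 * S + ∫ y, |ω s y|) * |t - s| := by
  set V := 8 * S + ∫ y, |ω s y| with hV
  have hu : ∀ τ ∈ Icc a b, ∀ x ∈ Hplane, ‖u τ x‖ ≤ V := fun τ hτ x hx =>
    (h.norm_velocity_le_sup_add_mass (h.abs_le_of_abs_le ha hK hs hτ hS) hx).trans
      (by linarith [h.integral_abs_le ha hK hs hτ])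
  have key : ∀ l : ℝ × ℝ →L[ℝ] ℝ, (∀ z, |l z| ≤ ‖z‖) → l x ≤ k + V * |t - s| := by
    intro l hl
    have hk' : ∀ x, ω s x ≠ 0 → l x ≤ k := fun x hx => (le_abs_self _).trans ((hl x).trans (hk x hx))
    rcases le_total s t with hst | hst
    · have hsub : Icc s t ⊆ Icc a b := Icc_subset_Icc hs.1 ht.2
      have hd : ∀ τ, HasDerivAt (fun τ => k + V * (τ - s)) V τ := fun τ => by
        simpa using (((hasDerivAt_id τ).sub_const s).const_mul V).const_add k
      have := h.barrier_forward (ρ := fun τ => k + V * (τ - s)) (ha.trans hs.1)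
        (fun τ hτ => hK τ (hsub hτ)) l (by fun_prop)
        (fun τ hτ x hx _ => by
          rw [(hd τ).deriv]
          exact (le_abs_self _).trans ((hl _).trans (hu τ (hsub ⟨hτ.1.le, hτ.2.le⟩) x hx)))
        (by simpa using hk') ⟨hst, le_rfl⟩ hx
      rwa [abs_of_nonneg (sub_nonneg.2 hst)]
    · have hsub : Icc t s ⊆ Icc a b := Icc_subset_Icc ht.1 hs.2
      have hd : ∀ τ, HasDerivAt (fun τ => k + V * (s - τ)) (-V) τ := fun τ => by
        simpa using (((hasDerivAt_id τ).const_sub s).const_mul V).const_add k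
      have := h.barrier_backward (ρ := fun τ => k + V * (s - τ)) (ha.trans ht.1)
        (fun τ hτ => hK τ (hsub hτ)) l (by fun_prop)
        (fun τ hτ x hx _ => by
          rw [(hd τ).deriv]
          exact neg_le_of_abs_le ((hl _).trans (hu τ (hsub ⟨hτ.1.le, hτ.2.le⟩) x hx)))
        (by simpa using hk') ⟨le_rfl, hst⟩ hx
      rwa [abs_sub_comm, abs_of_nonneg (sub_nonneg.2 hst)]
  have a1 := key (.fst ℝ ℝ ℝ) (fun z => norm_fst_le z)
  have a2 := key (-.fst ℝ ℝ ℝ) (fun z => by simpa using norm_fst_le z)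
  have a3 := key (.snd ℝ ℝ ℝ) (fun z => norm_snd_le z)
  have a4 := key (-.snd ℝ ℝ ℝ) (fun z => by simpa using norm_snd_le z)
  simp only [neg_apply, ContinuousLinearMap.coe_fst', ContinuousLinearMap.coe_snd'] at a1 a2 a3 a4
  rw [Prod.norm_def, Real.norm_eq_abs, Real.norm_eq_abs]
  exact max_le (abs_le.2 ⟨by linarith, a1⟩) (abs_le.2 ⟨by linarith, a3⟩)

end IsEulerSol

end Confinement

section UniformSupport

variable {ω : ℝ → ℝ × ℝ → ℝ} {u : ℝ → ℝ × ℝ → ℝ × ℝ}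

/-- The support of `ω t` lies in the closed ball of radius `K`. -/
def SuppLe (ω : ℝ → ℝ × ℝ → ℝ) (K t : ℝ) : Prop := ∀ x, ω t x ≠ 0 → ‖x‖ ≤ K

/-- The supports of `ω s` are uniformly bounded for nonnegative times `s` near `t`. -/
def SuppLocBdd (ω : ℝ → ℝ × ℝ → ℝ) (t : ℝ) : Prop := ∃ K, ∀ᶠ s in 𝓝 t, 0 ≤ s → SuppLe ω K s

lemma SuppLe.mono {K K' t : ℝ} (h : SuppLe ω K t) (hK : K ≤ K') : SuppLe ω K' t :=
  fun x hx => (h x hx).trans hK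

lemma isOpen_suppLocBdd : IsOpen {t | SuppLocBdd ω t} := by
  rw [isOpen_iff_mem_nhds]
  rintro t ⟨K, hK⟩
  filter_upwards [eventually_eventually_nhds.2 hK] with s hs using ⟨K, hs⟩

namespace IsEulerSol

lemma isClosed_suppLe (h : IsEulerSol ω u) (K : ℝ) : IsClosed {t | SuppLe ω K t} := by
  have : {t | SuppLe ω K t} = ⋂ x : ℝ × ℝ, {t | ω t x ≠ 0 → ‖x‖ ≤ K} := by
    ext; simp [SuppLe]
  rw [this]
  refine isClosed_iInter fun x => ?_
  by_cases hx : ‖x‖ ≤ K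
  · simp [hx]
  · simp only [hx, imp_false, not_not]
    exact isClosed_eq (h.contDiff_joint.continuous.comp (Continuous.prodMk_left x)) continuous_const

lemma exists_suppLe (h : IsEulerSol ω u) (t : ℝ) : ∃ K, SuppLe ω K t := by
  obtain ⟨K, hK⟩ := (h.compactSupp t).isCompact.isBounded.exists_norm_le
  exact ⟨K, fun x hx => hK x (subset_tsupport _ hx)⟩

lemma exists_suppLe_Icc {a b : ℝ} (ha : 0 ≤ a) (hg : ∀ t ∈ Icc a b, SuppLocBdd ω t) :
    ∃ K, ∀ t ∈ Icc a b, SuppLe ω K t := by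
  have : ∃ K, ∀ t ∈ Icc a b, 0 ≤ t → SuppLe ω K t := by
    refine isCompact_Icc.induction_on (p := fun s => ∃ K, ∀ t ∈ s, 0 ≤ t → SuppLe ω K t)
      ⟨0, by simp⟩ ?_ ?_ ?_
    · rintro s t hst ⟨K, hK⟩
      exact ⟨K, fun τ hτ => hK τ (hst hτ)⟩
    · rintro s t ⟨K, hK⟩ ⟨K', hK'⟩
      refine ⟨max K K', fun τ hτ h0 => ?_⟩
      rcases hτ with hτ | hτ
      · exact (hK τ hτ h0).mono (le_max_left _ _)
      · exact (hK' τ hτ h0).mono (le_max_right _ _)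
    · intro t ht
      obtain ⟨K, hK⟩ := hg t ht
      exact ⟨_, mem_nhdsWithin_of_mem_nhds hK, K, fun τ hτ => hτ⟩
  obtain ⟨K, hK⟩ := this
  exact ⟨K, fun t ht => hK t ht (ha.trans ht.1)⟩

lemma exists_suppLe_Icc_of_Ioo (h : IsEulerSol ω u) {a b : ℝ} (ha : 0 ≤ a) (hab : a < b)
    (hg : ∀ t ∈ Ioo a b, SuppLocBdd ω t) : ∃ K, ∀ t ∈ Icc a b, SuppLe ω K t := by
  obtain ⟨c, hc⟩ := exists_between hab
  obtain ⟨k, hk⟩ := h.exists_suppLe c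
  obtain ⟨S, hS⟩ := h.exists_abs_le c
  have hS0 : 0 ≤ S := (abs_nonneg _).trans (hS 0)
  have hV : 0 ≤ 8 * S + ∫ y, |ω c y| := by
    have : 0 ≤ ∫ y, |ω c y| := integral_nonneg fun _ => abs_nonneg _
    positivity
  let K := k + (8 * S + ∫ y, |ω c y|) * (b - a)
  have hIoo : Ioo a b ⊆ {t | SuppLe ω K t} := by
    intro t ht x hx
    have hsub : uIcc c t ⊆ Ioo a b := ordConnected_Ioo.uIcc_subset hc ht
    have hmin : 0 ≤ min c t := ha.trans (le_min hc.1.le ht.1.le)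
    obtain ⟨K', hK'⟩ := exists_suppLe_Icc hmin fun τ hτ => hg τ (hsub hτ)
    refine (h.norm_le_of_norm_le hmin hK' left_mem_uIcc right_mem_uIcc hS hk hx).trans ?_
    have hle : |t - c| ≤ b - a :=
      abs_le.2 ⟨by linarith [hc.2, ht.1], by linarith [hc.1, ht.2]⟩
    exact add_le_add_right (mul_le_mul_of_nonneg_left hle hV) k
  refine ⟨K, fun t ht => ?_⟩
  rw [← closure_Ioo hab.ne] at ht
  exact (h.isClosed_suppLe K).closure_subset_iff.2 hIoo ht

/-- Speed bound in terms of the size of the support at one time only. -/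
lemma exists_speed (h : IsEulerSol ω u) (k : ℝ) (c d : ℝ) : ∃ V, 0 ≤ V ∧
    ∀ a b, 0 ≤ a → a < b → (∀ t ∈ Ioo a b, SuppLocBdd ω t) → ∀ s ∈ Icc a b, ∀ t ∈ Icc a b,
      s ∈ Icc c d → SuppLe ω k s → SuppLe ω (k + V * |t - s|) t := by
  obtain ⟨S', hS'⟩ := (isCompact_Icc.prod (isCompact_closedBall (0 : ℝ × ℝ) k)).exists_bound_of_continuousOn
    (s := Icc c d ×ˢ Metric.closedBall (0 : ℝ × ℝ) k) h.contDiff_joint.continuous.continuousOn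
  set S := max S' 0
  set B := Metric.closedBall (0 : ℝ × ℝ) k with hB
  have hS0 : 0 ≤ S := le_max_right _ _
  refine ⟨8 * S + S * volume.real B, by positivity, ?_⟩
  intro a b ha hab hg s hs t ht hscd hsk x hx
  obtain ⟨K, hK⟩ := h.exists_suppLe_Icc_of_Ioo ha hab hg
  have hb : ∀ y, |ω s y| ≤ B.indicator (fun _ => S) y := by
    intro y
    by_cases hy : y ∈ B
    · rw [indicator_of_mem hy]
      exact (hS' (s, y) ⟨hscd, hy⟩).trans (le_max_left _ _)
    · have : ω s y = 0 := by
        by_contra hne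
        exact hy (by simpa [hB] using hsk y hne)
      simp [this, indicator_of_notMem hy]
  have hb' : ∀ y, |ω s y| ≤ S := fun y =>
    (hb y).trans (indicator_le_self' (fun _ _ => hS0) y)
  have hN : ∫ y, |ω s y| ≤ S * volume.real B := by
    have hind : Integrable (B.indicator fun _ : ℝ × ℝ => S) :=
      (integrable_indicator_iff measurableSet_closedBall).2
        (integrableOn_const (isCompact_closedBall _ _).measure_lt_top.ne)
    refine (integral_mono (h.integrable_slice s).abs hind hb).trans ?_
    rw [integral_indicator measurableSet_closedBall]
    simp [hB, mul_comm]
  refine (h.norm_le_of_norm_le ha hK hs ht hb' hsk hx).trans ?_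
  gcongr

lemma suppLocBdd (h : IsEulerSol ω u) (t : ℝ) : SuppLocBdd ω t := by
  by_contra hbad
  set B : Set ℝ := {t | SuppLocBdd ω t}ᶜ with hBdef
  have hB : IsClosed B := isOpen_suppLocBdd.isClosed_compl
  have hB0 : ∀ t ∈ B, 0 ≤ t := by
    intro t ht
    by_contra hneg
    refine ht ⟨0, ?_⟩
    filter_upwards [Iio_mem_nhds (not_le.1 hneg)] with s hs h0
    exact absurd h0 (not_le.2 hs)
  have : Nonempty B := ⟨t, hbad⟩
  have : CompleteSpace B := hB.completeSpace_coe
  obtain ⟨k, p, hp⟩ := nonempty_interior_of_iUnion_of_closed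
    (f := fun k : ℕ => {t : B | SuppLe ω k t})
    (fun k => (h.isClosed_suppLe k).preimage continuous_subtype_val)
    (by
      refine eq_univ_of_forall fun t => mem_iUnion.2 ?_
      obtain ⟨K, hK⟩ := h.exists_suppLe t
      obtain ⟨k, hk⟩ := exists_nat_ge K
      exact ⟨k, hK.mono hk⟩)
  rw [mem_interior_iff_mem_nhds, Metric.mem_nhds_iff] at hp
  obtain ⟨ε, hε, hball⟩ := hp
  have hk : ∀ s ∈ B, |s - p| < ε → SuppLe ω k s := fun s hs hsp =>
    hball (show (⟨s, hs⟩ : B) ∈ Metric.ball p ε from hsp)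
  obtain ⟨V, hV, hspeed⟩ := h.exists_speed k (p - ε) (p + ε)
  refine p.2 ⟨k + V * ε, ?_⟩
  filter_upwards [Metric.ball_mem_nhds (p : ℝ) hε] with t ht ht0
  have ht : |t - p| < ε := ht
  obtain ⟨ht1, ht2⟩ := abs_lt.1 ht
  by_cases htB : t ∈ B
  · exact (hk t htB ht).mono (by nlinarith)
  have hpt : (p : ℝ) ≠ t := fun hpt => htB (hpt ▸ p.2)
  rcases lt_or_gt_of_ne hpt with hlt | hlt
  · have hcomp : IsCompact (B ∩ Icc (p : ℝ) t) := isCompact_Icc.inter_left hB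
    obtain ⟨a, ⟨haB, haI⟩, hamax⟩ := hcomp.exists_isGreatest ⟨p, p.2, le_rfl, hlt.le⟩
    have hat : a < t := lt_of_le_of_ne haI.2 fun e => htB (e ▸ haB)
    have hap : |a - p| < ε := abs_lt.2 ⟨by linarith [haI.1], by linarith⟩
    refine (hspeed a t (hB0 a haB) hat (fun τ hτ => ?_) a ⟨le_rfl, hat.le⟩ t ⟨hat.le, le_rfl⟩
      ⟨by linarith [haI.1], by linarith⟩ (hk a haB hap)).mono ?_
    · by_contra hτB
      exact hτ.1.not_ge (hamax ⟨hτB, haI.1.trans hτ.1.le, hτ.2.le⟩)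
    · gcongr
      exact abs_le.2 ⟨by linarith, by linarith [haI.1]⟩
  · have hcomp : IsCompact (B ∩ Icc t (p : ℝ)) := isCompact_Icc.inter_left hB
    obtain ⟨a, ⟨haB, haI⟩, hamin⟩ := hcomp.exists_isLeast ⟨p, p.2, hlt.le, le_rfl⟩
    have hat : t < a := lt_of_le_of_ne haI.1 fun e => htB (e ▸ haB)
    have hap : |a - p| < ε := abs_lt.2 ⟨by linarith, by linarith [haI.2]⟩
    refine (hspeed t a ht0 hat (fun τ hτ => ?_) a ⟨hat.le, le_rfl⟩ t ⟨le_rfl, hat.le⟩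
      ⟨by linarith, by linarith [haI.2]⟩ (hk a haB hap)).mono ?_
    · by_contra hτB
      exact hτ.2.not_ge (hamin ⟨hτB, hτ.1.le, hτ.2.le.trans haI.2⟩)
    · gcongr
      exact abs_le.2 ⟨by linarith [haI.2], by linarith⟩

lemma exists_uniform_support (h : IsEulerSol ω u) (T : ℝ) :
    ∃ K, ∀ t ∈ Icc 0 T, ∀ x, ω t x ≠ 0 → ‖x‖ ≤ K :=
  exists_suppLe_Icc le_rfl fun t _ => h.suppLocBdd t

end IsEulerSol

end UniformSupport

lemma abs_exp_sub_exp_le (p q : ℝ) :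
    |Real.exp p - Real.exp q| ≤ |p - q| * (Real.exp p + Real.exp q) := by
  have key : ∀ p q : ℝ, Real.exp p - Real.exp q ≤ |p - q| * (Real.exp p + Real.exp q) := by
    intro p q
    have h1 := Real.add_one_le_exp (q - p)
    have h2 : Real.exp q = Real.exp (q - p) * Real.exp p := by rw [← Real.exp_add]; ring_nf
    have h3 := Real.exp_pos p
    have h4 := Real.exp_pos q
    nlinarith [le_abs_self (p - q), mul_nonneg (abs_nonneg (p - q)) h4.le]
  refine abs_le.2 ⟨?_, key p q⟩
  have := key q p
  rw [abs_sub_comm] at this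
  linarith

lemma Kker_fst (x y : ℝ × ℝ) : (Kker x y).1 =
    -((2 * Real.pi * nrm (x - y) ^ 2)⁻¹ * (x.2 - y.2))
      + (2 * Real.pi * nrm (x - pbar y) ^ 2)⁻¹ * (x.2 + y.2) := by
  simp [Kker, perp, pbar]
  ring

/-- Symmetrizing the horizontal kernel against a decreasing exponential leaves only a bounded
negative part. -/
lemma neg_le_symmetrized_Kker {x y : ℝ × ℝ} (hx : x ∈ Hplane) (hy : y ∈ Hplane) {l : ℝ}
    (hl : 0 ≤ l) :
    -(l * (Real.exp (-l * x.1) + Real.exp (-l * y.1))) ≤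
      Real.exp (-l * x.1) * (Kker x y).1 + Real.exp (-l * y.1) * (Kker y x).1 := by
  have hx : 0 < x.2 := hx
  have hy : 0 < y.2 := hy
  rw [Kker_fst, Kker_fst]
  have e1 : nrm (y - x) ^ 2 = nrm (x - y) ^ 2 := by simp only [nrm_sq, Prod.fst_sub, Prod.snd_sub]; ring
  have e2 : nrm (y - pbar x) ^ 2 = nrm (x - pbar y) ^ 2 := by
    simp only [nrm_sq, Prod.fst_sub, Prod.snd_sub, pbar]; ring
  rw [e1, e2]
  have hB : 0 ≤ (2 * Real.pi * nrm (x - pbar y) ^ 2)⁻¹ := by positivity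
  have hA : 0 ≤ (2 * Real.pi * nrm (x - y) ^ 2)⁻¹ := by positivity
  have hA' : (2 * Real.pi * nrm (x - y) ^ 2)⁻¹ * (|x.1 - y.1| * |x.2 - y.2|) ≤ 1 := by
    refine inv_mul_le_one_of_le₀ ?_ (by positivity)
    rw [nrm_sq]
    simp only [Prod.fst_sub, Prod.snd_sub]
    have h1 : |x.1 - y.1| * |x.2 - y.2| ≤ (x.1 - y.1) ^ 2 + (x.2 - y.2) ^ 2 := by
      rw [← sq_abs (x.1 - y.1), ← sq_abs (x.2 - y.2)]
      nlinarith [sq_nonneg (|x.1 - y.1| - |x.2 - y.2|), sq_nonneg |x.1 - y.1|, sq_nonneg |x.2 - y.2|]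
    have h2 : 0 ≤ (x.1 - y.1) ^ 2 + (x.2 - y.2) ^ 2 := by positivity
    nlinarith [Real.pi_gt_three]
  set A := (2 * Real.pi * nrm (x - y) ^ 2)⁻¹
  set B := (2 * Real.pi * nrm (x - pbar y) ^ 2)⁻¹
  have hd := abs_exp_sub_exp_le (-l * x.1) (-l * y.1)
  have hd' : |-l * x.1 - -l * y.1| = l * |x.1 - y.1| := by
    rw [show -l * x.1 - -l * y.1 = -(l * (x.1 - y.1)) by ring, abs_neg, abs_mul, abs_of_nonneg hl]
  rw [hd'] at hd
  have p1 := Real.exp_pos (-l * x.1)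
  have p2 := Real.exp_pos (-l * y.1)
  set X := Real.exp (-l * x.1)
  set Y := Real.exp (-l * y.1)
  have h1 : A * ((x.2 - y.2) * (X - Y)) ≤ l * (X + Y) := by
    calc A * ((x.2 - y.2) * (X - Y)) ≤ A * (|x.2 - y.2| * |X - Y|) := by
          rw [← abs_mul]; gcongr; exact le_abs_self _
      _ ≤ A * (|x.2 - y.2| * (l * |x.1 - y.1| * (X + Y))) := by gcongr
      _ = A * (|x.1 - y.1| * |x.2 - y.2|) * (l * (X + Y)) := by ring
      _ ≤ 1 * (l * (X + Y)) := by gcongr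
      _ = _ := one_mul _
  have h2 : 0 ≤ B * (x.2 + y.2) * (X + Y) := by positivity
  nlinarith

section ExponentialMoment

variable {ω : ℝ → ℝ × ℝ → ℝ} {u : ℝ → ℝ × ℝ → ℝ × ℝ}

namespace IsEulerSol

lemma continuous_exp_fst (l : ℝ) : Continuous (fun x : ℝ × ℝ => Real.exp (-l * x.1)) := by fun_prop

lemma integrable_exp_mul (h : IsEulerSol ω u) (t l : ℝ) :
    Integrable (fun x => Real.exp (-l * x.1) * ω t x) :=
  ((continuous_exp_fst l).mul (h.continuous_slice t)).integrable_of_hasCompactSupport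
    (h.compactSupp t).mul_left

lemma neg_le_integral_exp_velocity (h : IsEulerSol ω u) (t : ℝ) (hn : ∀ x, 0 ≤ ω t x) {l : ℝ}
    (hl : 0 ≤ l) :
    -(l * (∫ x, ω t x) * ∫ x, Real.exp (-l * x.1) * ω t x)
      ≤ ∫ x, Real.exp (-l * x.1) * ω t x * (u t x).1 := by
  set L : ℝ × ℝ → (ℝ × ℝ →L[ℝ] ℝ) :=
    fun x => (Real.exp (-l * x.1) * ω t x) • ContinuousLinearMap.fst ℝ ℝ ℝ with hL
  obtain ⟨hint, heq⟩ := h.integral_clm_velocity t (L := L)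
    (((continuous_exp_fst l).mul (h.continuous_slice t)).smul continuous_const)
    ((h.compactSupp t).mono' fun x hx => by
      by_contra hx'
      exact hx (by simp [hL, image_eq_zero_of_notMem_tsupport hx']))
    (fun x hx => by simp [hL, h.eq_zero_of_notMem t hx])
  set H : (ℝ × ℝ) × (ℝ × ℝ) → ℝ := fun q => ω t q.2 * L q.1 (Kker q.1 q.2) with hH
  have hI : ∫ x, Real.exp (-l * x.1) * ω t x * (u t x).1 = ∫ q, H q ∂(volume.prod volume) := by
    rw [integral_prod _ hint, ← heq]
    simp [hL]
  have hswap : ∫ q, H q.swap ∂(volume.prod volume) = ∫ q, H q ∂(volume.prod volume) :=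
    integral_prod_swap H
  have hint' : Integrable (fun q => H q.swap) (volume.prod volume) := hint.swap
  have j1 := (h.integrable_exp_mul t l).mul_prod (h.integrable_slice t)
  have j2 := (h.integrable_slice t).mul_prod (h.integrable_exp_mul t l)
  have hlow : ∫ q : (ℝ × ℝ) × (ℝ × ℝ), (-l) * ((Real.exp (-l * q.1.1) * ω t q.1) * ω t q.2
        + ω t q.1 * (Real.exp (-l * q.2.1) * ω t q.2)) ∂(volume.prod volume)
      ≤ ∫ q, (H q + H q.swap) ∂(volume.prod volume) := by
    refine integral_mono ((j1.add j2).const_mul (-l)) (hint.add hint') fun q => ?_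
    obtain ⟨x, y⟩ := q
    by_cases hx : x ∈ Hplane
    · by_cases hy : y ∈ Hplane
      · have := mul_le_mul_of_nonneg_left (neg_le_symmetrized_Kker hx hy hl)
          (mul_nonneg (hn x) (hn y))
        simp only [hH, hL, Prod.swap, smul_apply, ContinuousLinearMap.coe_fst', smul_eq_mul]
        linarith
      · simp [hH, hL, h.eq_zero_of_notMem t hy]
    · simp [hH, hL, h.eq_zero_of_notMem t hx]
  rw [integral_const_mul, integral_add j1 j2, integral_add hint hint', hswap,
    integral_prod_mul (fun x => Real.exp (-l * x.1) * ω t x) (ω t),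
    integral_prod_mul (ω t) (fun x => Real.exp (-l * x.1) * ω t x)] at hlow
  rw [hI]
  linarith

lemma integral_exp_mul_le (h : IsEulerSol ω u) (hn : ∀ x, 0 ≤ ω 0 x) {t l : ℝ} (ht : 0 ≤ t)
    (hl : 0 ≤ l) :
    ∫ x, Real.exp (-l * x.1) * ω t x
      ≤ (∫ x, Real.exp (-l * x.1) * ω 0 x) * Real.exp ((∫ x, ω 0 x) * l ^ 2 * t) := by
  obtain ⟨K, hK⟩ := h.exists_uniform_support t
  have h00 : (0 : ℝ) ∈ Icc 0 t := ⟨le_rfl, ht⟩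
  set M := ∫ x, ω 0 x with hM
  set E : ℝ → ℝ := fun t => ∫ x, Real.exp (-l * x.1) * ω t x with hE
  have hφ : ContDiff ℝ 1 (fun q : ℝ × (ℝ × ℝ) => Real.exp (-l * q.2.1)) := by fun_prop
  have hd : ∀ s ∈ Ioo 0 t, HasDerivAt E
      (-l * ∫ x, Real.exp (-l * x.1) * ω s x * (u s x).1) s := by
    intro s hs
    refine (h.hasDerivAt_integral le_rfl hK (φ := fun _ x => Real.exp (-l * x.1)) hφ
      (β := fun z => z) contDiff_id rfl hs).congr_deriv ?_
    rw [← integral_const_mul]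
    refine integral_congr_ae (ae_of_all _ fun x => ?_)
    have d : HasFDerivAt (fun x : ℝ × ℝ => Real.exp (-l * x.1))
        (Real.exp (-l * x.1) • ((-l) • ContinuousLinearMap.fst ℝ ℝ ℝ)) x :=
      (hasFDerivAt_fst.const_mul (-l)).exp
    simp only [d.fderiv, deriv_const, smul_apply, ContinuousLinearMap.coe_fst', smul_eq_mul]
    ring
  have hc : ContinuousOn E (Icc 0 t) :=
    h.continuousOn_integral hK (φ := fun _ x => Real.exp (-l * x.1)) hφ.continuous
      (β := fun z => z) continuous_id rfl
  have hexp : ∀ s, HasDerivAt (fun s => Real.exp (-(M * l ^ 2) * s))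
      (Real.exp (-(M * l ^ 2) * s) * (-(M * l ^ 2))) s := fun s => by
    simpa using ((hasDerivAt_id s).const_mul (-(M * l ^ 2))).exp
  have hanti := antitoneOn_of_deriv_nonpos (convex_Icc 0 t)
    (f := fun s => E s * Real.exp (-(M * l ^ 2) * s)) (hc.mul (by fun_prop))
    (by
      rw [interior_Icc]
      exact fun s hs => ((hd s hs).mul (hexp s)).differentiableAt.differentiableWithinAt)
    (by
      rw [interior_Icc]
      intro s hs
      have hs' : s ∈ Icc 0 t := ⟨hs.1.le, hs.2.le⟩
      have hds : HasDerivAt (fun s => E s * Real.exp (-(M * l ^ 2) * s)) _ s :=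
        (hd s hs).mul (hexp s)
      rw [hds.deriv]
      have h1 := h.neg_le_integral_exp_velocity s (h.nonneg_of_nonneg le_rfl hK h00 hs' hn) hl
      have h2 : ∫ x, ω s x = M := h.integral_comp_eq le_rfl hK (β := fun z => z) contDiff_id rfl
        h00 hs'
      rw [h2] at h1
      have h3 : -l * (∫ x, Real.exp (-l * x.1) * ω s x * (u s x).1) ≤ M * l ^ 2 * E s := by
        have := mul_le_mul_of_nonneg_left h1 hl
        simp only [hE]
        linarith
      have h4 := Real.exp_pos (-(M * l ^ 2) * s)
      nlinarith)
  have h5 := hanti h00 ⟨ht, le_rfl⟩ ht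
  simp only [mul_zero, Real.exp_zero, mul_one] at h5
  have h6 : Real.exp (-(M * l ^ 2) * t) * Real.exp (M * l ^ 2 * t) = 1 := by
    rw [← Real.exp_add]; simp
  calc E t = E t * Real.exp (-(M * l ^ 2) * t) * Real.exp (M * l ^ 2 * t) := by
        rw [mul_assoc, h6, mul_one]
    _ ≤ E 0 * Real.exp (M * l ^ 2 * t) := by gcongr

end IsEulerSol

end ExponentialMoment

lemma exists_contDiff_extension {a : ℝ} {q q' : ℝ → ℝ} (hq : ∀ t ∈ Ici a, HasDerivAt q (q' t) t)
    (hc : ContinuousOn q' (Ici a)) :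
    ∃ ρ : ℝ → ℝ, ContDiff ℝ 1 ρ ∧ ∀ t ∈ Ici a, ρ t = q t ∧ deriv ρ t = q' t := by
  have hg : Continuous fun s => q' (max a s) :=
    hc.comp_continuous (by fun_prop) fun s => mem_Ici.2 (le_max_left _ _)
  have hd : ∀ t, HasDerivAt (fun t => q a + ∫ s in a..t, q' (max a s)) (q' (max a t)) t := fun t =>
    (hg.integral_hasStrictDerivAt a t).hasDerivAt.const_add _
  refine ⟨fun t => q a + ∫ s in a..t, q' (max a s), ?_, fun t ht => ⟨?_, ?_⟩⟩
  · rw [contDiff_one_iff_deriv]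
    exact ⟨fun t => (hd t).differentiableAt, by rwa [funext fun t => (hd t).deriv]⟩
  · have : ∫ s in a..t, q' (max a s) = q t - q a := by
      refine intervalIntegral.integral_eq_sub_of_hasDerivAt (fun s hs => ?_)
        (hg.intervalIntegrable _ _)
      rw [uIcc_of_le ht] at hs
      rw [max_eq_right hs.1]
      exact hq s hs.1
    simp only [this]
    ring
  · rw [(hd t).deriv, max_eq_right ht]

lemma hasDerivAt_sqrt_of_mul_log {t : ℝ} (ht : 1 < t) :
    HasDerivAt (fun t => Real.sqrt (t * Real.log t))
      ((Real.log t + 1) / (2 * Real.sqrt (t * Real.log t))) t := by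
  have h0 : 0 < t := by linarith
  have h1 := Real.log_pos ht
  exact (by simpa using Real.hasDerivAt_mul_log h0.ne' :
    HasDerivAt (fun t => t * Real.log t) (Real.log t + 1) t).sqrt (by positivity)

section Confinement

variable {ω : ℝ → ℝ × ℝ → ℝ} {u : ℝ → ℝ × ℝ → ℝ × ℝ}

namespace IsEulerSol

lemma norm_velocity_le_left (h : IsEulerSol ω u) {t S R r l : ℝ} (hn : ∀ y, 0 ≤ ω t y)
    (hS : ∀ y, ω t y ≤ S) (hR : 0 < R) (hr : 0 < r) (hl : 0 ≤ l) {x : ℝ × ℝ} (hx : x ∈ Hplane)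
    (hxR : x.1 ≤ -R) :
    ‖u t x‖ ≤ 8 * r * S + Real.exp (-(l * R / 2)) * (∫ y, Real.exp (-l * y.1) * ω t y) / r
      + 2 * (∫ y, ω t y) / R := by
  set A : Set (ℝ × ℝ) := {y | y.1 < -(R / 2)} with hA
  have hAm : MeasurableSet A := measurableSet_lt measurable_fst measurable_const
  set f := A.indicator (ω t) with hf
  have hfi : Integrable f := (h.integrable_slice t).indicator hAm
  have hf0 : ∀ y, 0 ≤ f y := fun y => indicator_nonneg (fun y _ => hn y) y
  have hfS : ∀ y, f y ≤ S := fun y => (indicator_le_self' (fun y _ => hn y) y).trans (hS y)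
  have hfint : ∫ y, f y ≤ Real.exp (-(l * R / 2)) * ∫ y, Real.exp (-l * y.1) * ω t y := by
    rw [← integral_const_mul]
    refine integral_mono hfi ((h.integrable_exp_mul t l).const_mul _) fun y => ?_
    by_cases hy : y ∈ A
    · have hy' : y.1 < -(R / 2) := hy
      simp only [hf, indicator_of_mem hy]
      rw [← mul_assoc, ← Real.exp_add]
      refine le_mul_of_one_le_left (hn y) (Real.one_le_exp ?_)
      nlinarith
    · simp only [hf, indicator_of_notMem hy]
      have := hn y
      positivity
  calc ‖u t x‖ ≤ ∫ y, |ω t y| * ‖x - y‖⁻¹ := h.norm_velocity_le t hx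
    _ ≤ ∫ y, (f y * ‖x - y‖⁻¹ + 2 / R * ω t y) := by
        refine integral_mono (h.integrable_abs_mul_inv_norm t x)
          ((integrable_mul_inv_norm hfi hf0 hfS x).add ((h.integrable_slice t).const_mul _))
          fun y => ?_
        simp only [abs_of_nonneg (hn y)]
        by_cases hy : y ∈ A
        · simp only [hf, indicator_of_mem hy]
          have := mul_nonneg (div_pos two_pos hR).le (hn y)
          linarith
        · have hy' : -(R / 2) ≤ y.1 := not_lt.1 hy
          simp only [hf, indicator_of_notMem hy, zero_mul, zero_add]
          rw [mul_comm]
          refine mul_le_mul_of_nonneg_right ?_ (hn y)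
          have h1 : R / 2 ≤ ‖x - y‖ := by
            have h2 := norm_fst_le (x - y)
            rw [Real.norm_eq_abs, Prod.fst_sub] at h2
            linarith [neg_abs_le (x.1 - y.1)]
          rw [← inv_div R 2]
          exact inv_anti₀ (by positivity) h1
    _ = (∫ y, f y * ‖x - y‖⁻¹) + 2 * (∫ y, ω t y) / R := by
        rw [integral_add (integrable_mul_inv_norm hfi hf0 hfS x)
          ((h.integrable_slice t).const_mul _), integral_const_mul]
        ring
    _ ≤ (8 * r * S + (∫ y, f y) / r) + 2 * (∫ y, ω t y) / R := by
        gcongr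
        exact integral_mul_inv_norm_le hfi hr hf0 hfS x
    _ ≤ _ := by gcongr

lemma integral_exp_mul_le_of_support {K l : ℝ} (h : IsEulerSol ω u) (hn : ∀ x, 0 ≤ ω 0 x)
    (hK : ∀ x, ω 0 x ≠ 0 → ‖x‖ ≤ K) (hK0 : 0 ≤ K) (hl : 0 ≤ l) (hl1 : l ≤ 1) :
    ∫ x, Real.exp (-l * x.1) * ω 0 x ≤ (∫ x, ω 0 x) * Real.exp K := by
  rw [mul_comm, ← integral_const_mul]
  refine integral_mono (h.integrable_exp_mul 0 l) ((h.integrable_slice 0).const_mul _) fun x => ?_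
  by_cases hx : ω 0 x = 0
  · simp [hx]
  · refine mul_le_mul_of_nonneg_right (Real.exp_le_exp.2 ?_) (hn x)
    have h1 := (norm_fst_le x).trans (hK x hx)
    rw [Real.norm_eq_abs] at h1
    nlinarith [neg_abs_le x.1, abs_nonneg x.1]

end IsEulerSol

lemma drift_bound {M S C D τ : ℝ} (hM : 0 ≤ M) (hS : 0 ≤ S) (hC : 0 ≤ C)
    (hD : 4 + 2 * M + 16 * S + 2 * C ≤ D) (hτ : 2 ≤ τ) {E : ℝ}
    (hE : E ≤ C * Real.exp (M * Real.log τ)) :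
    8 * τ⁻¹ * S + Real.exp (-(D * Real.log τ / 2)) * E / τ⁻¹
        + 2 * M / (D * Real.sqrt (τ * Real.log τ))
      ≤ D * ((Real.log τ + 1) / (2 * Real.sqrt (τ * Real.log τ))) := by
  have hτ0 : 0 < τ := by linarith
  have hL : 0 < Real.log τ := Real.log_pos (by linarith)
  have hLτ : Real.log τ ≤ τ := Real.log_le_self hτ0.le
  set L := Real.log τ with hLdef
  set q := Real.sqrt (τ * L) with hq
  have hq0 : 0 < q := Real.sqrt_pos.2 (by positivity)
  have hqτ : q ≤ τ := by
    refine (Real.sqrt_le_sqrt (mul_le_mul_of_nonneg_left hLτ hτ0.le)).trans ?_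
    rw [Real.sqrt_mul_self hτ0.le]
  have hinv : τ⁻¹ ≤ q⁻¹ := inv_anti₀ hq0 hqτ
  have hD0 : 0 < D := by linarith
  have h2 : Real.exp (-(D * L / 2)) * E / τ⁻¹ ≤ C * q⁻¹ := by
    have e1 : Real.exp (-(D * L / 2)) * Real.exp (M * L) ≤ τ⁻¹ * τ⁻¹ := by
      have e2 : τ⁻¹ = Real.exp (-L) := by rw [Real.exp_neg, Real.exp_log hτ0]
      rw [e2, ← Real.exp_add, ← Real.exp_add]
      refine Real.exp_le_exp.2 ?_
      nlinarith
    calc Real.exp (-(D * L / 2)) * E / τ⁻¹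
        ≤ Real.exp (-(D * L / 2)) * (C * Real.exp (M * L)) / τ⁻¹ := by gcongr
      _ = C * (Real.exp (-(D * L / 2)) * Real.exp (M * L)) * τ := by rw [div_inv_eq_mul]; ring
      _ ≤ C * (τ⁻¹ * τ⁻¹) * τ := by gcongr
      _ = C * τ⁻¹ := by field_simp
      _ ≤ C * q⁻¹ := by gcongr
  have h1 : 8 * τ⁻¹ * S ≤ 8 * S * q⁻¹ := by nlinarith
  have h3 : 2 * M / (D * q) ≤ q⁻¹ := by
    rw [div_le_iff₀ (by positivity)]
    have : q⁻¹ * (D * q) = D := by field_simp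
    linarith
  have h4 : D * ((L + 1) / (2 * q)) = D * (L + 1) / 2 * q⁻¹ := by
    field_simp
  rw [h4]
  have h5 : (8 * S + C + 1) * q⁻¹ ≤ D * (L + 1) / 2 * q⁻¹ :=
    mul_le_mul_of_nonneg_right (by nlinarith) (inv_nonneg.2 hq0.le)
  linarith

end Confinement

/-- Theorem 2.2 (one-sided horizontal confinement to the left): there is a
constant `D > 0`, depending only on `ω₀`, such that for all `t > 2` the
support of `ω(t,·)` is contained in `{x ∈ ℍ : x₁ ≥ -D (t log t)^{1/2}}`. -/
theorem stmt_5 (ω : ℝ → ℝ × ℝ → ℝ) (u : ℝ → ℝ × ℝ → ℝ × ℝ)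
    (hsol : IsEulerSol ω u) (hnonneg : ∀ x, 0 ≤ ω 0 x) :
    ∃ D : ℝ, 0 < D ∧
      ∀ t : ℝ, 2 < t →
        tsupport (ω t) ⊆ {x : ℝ × ℝ | x ∈ Hplane ∧
          -(D * Real.sqrt (t * Real.log t)) ≤ x.1} := by
  obtain ⟨S, hS⟩ := hsol.exists_abs_le 0
  have hS0 : 0 ≤ S := (abs_nonneg _).trans (hS 0)
  obtain ⟨K, hK⟩ := hsol.exists_suppLe 0
  obtain ⟨K', hK'⟩ := hsol.exists_suppLe 2
  set M := ∫ x, ω 0 x with hM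
  have hM0 : 0 ≤ M := integral_nonneg hnonneg
  set C := M * Real.exp (max K 0) with hC
  have hC0 : 0 ≤ C := by positivity
  have hK'0 := le_max_right K' 0
  set D := 4 + 2 * M + 16 * S + 2 * C + max K' 0 with hD
  have hD0 : 0 < D := by linarith
  refine ⟨D, hD0, fun t ht => ?_⟩
  have hq : ∀ s ∈ Ici (2 : ℝ), HasDerivAt (fun s => D * Real.sqrt (s * Real.log s))
      (D * ((Real.log s + 1) / (2 * Real.sqrt (s * Real.log s)))) s := fun s hs =>
    (hasDerivAt_sqrt_of_mul_log (one_lt_two.trans_le hs)).const_mul D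
  have hpos : ∀ s ∈ Ici (2 : ℝ), 0 < Real.sqrt (s * Real.log s) := fun s hs =>
    Real.sqrt_pos.2 (mul_pos (two_pos.trans_le hs) (Real.log_pos (one_lt_two.trans_le hs)))
  have hlog : ContinuousOn Real.log (Ici 2) :=
    Real.continuousOn_log.mono fun s hs => (two_pos.trans_le hs).ne'
  obtain ⟨ρ, hρ, hρq⟩ := exists_contDiff_extension hq
    (continuousOn_const.mul ((hlog.add continuousOn_const).div
      (continuousOn_const.mul (continuousOn_id.mul hlog).sqrt)
      fun s hs => (mul_pos two_pos (hpos s hs)).ne'))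
  obtain ⟨R, hR⟩ := hsol.exists_uniform_support t
  have ht0 : 0 ≤ t := by linarith
  have h00 : (0 : ℝ) ∈ Icc 0 t := ⟨le_rfl, ht0⟩
  have hbarrier : ∀ x, ω t x ≠ 0 → -(D * Real.sqrt (t * Real.log t)) ≤ x.1 := by
    intro x hx
    have key := hsol.barrier_forward (a := 2) (b := t) two_pos.le
      (fun s hs => hR s ⟨two_pos.le.trans hs.1, hs.2⟩) (-ContinuousLinearMap.fst ℝ ℝ ℝ) hρ
      ?_ ?_ ⟨ht.le, le_rfl⟩ hx
    · rw [(hρq t ht.le).1] at key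
      simp only [neg_apply, ContinuousLinearMap.coe_fst'] at key
      linarith
    · intro τ hτ y hy hyl
      have hτ2 : τ ∈ Ici (2 : ℝ) := hτ.1.le
      have hτ0 : 0 < τ := two_pos.trans hτ.1
      have hτI : τ ∈ Icc 0 t := ⟨hτ0.le, hτ.2.le⟩
      rw [(hρq τ hτ2).1] at hyl
      rw [(hρq τ hτ2).2]
      simp only [neg_apply, ContinuousLinearMap.coe_fst'] at hyl ⊢
      have hqpos := hpos τ hτ2
      have hsq : Real.sqrt (τ * Real.log τ) ^ 2 = τ * Real.log τ :=
        Real.sq_sqrt (Real.sqrt_pos.1 hqpos).le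
      have hLτ : Real.log τ ≤ τ := Real.log_le_self hτ0.le
      set q := Real.sqrt (τ * Real.log τ) with hqdef
      have hl1 : q / τ ≤ 1 := by
        rw [div_le_one hτ0]
        nlinarith
      have hl0 : 0 ≤ q / τ := by positivity
      have hexp := (hsol.integral_exp_mul_le hnonneg hτ0.le hl0).trans
        (mul_le_mul_of_nonneg_right (hsol.integral_exp_mul_le_of_support hnonneg
          (hK.mono (le_max_left K 0)) (le_max_right K 0) hl0 hl1) (Real.exp_pos _).le)
      have e1 : M * (q / τ) ^ 2 * τ = M * Real.log τ := by
        rw [div_pow, hsq]; field_simp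
      rw [← hM, e1, ← hC] at hexp
      have hvel := hsol.norm_velocity_le_left (t := τ) (S := S) (R := D * q) (r := τ⁻¹)
        (hsol.nonneg_of_nonneg le_rfl hR h00 hτI hnonneg)
        (fun y => (le_abs_self _).trans (hsol.abs_le_of_abs_le le_rfl hR h00 hτI hS y))
        (by positivity) (by positivity) hl0 hy (by linarith)
      have e2 : ∫ y, ω τ y = M :=
        hsol.integral_comp_eq le_rfl hR (β := fun z => z) contDiff_id rfl h00 hτI
      have e3 : q / τ * (D * q) / 2 = D * Real.log τ / 2 := by
        rw [show q / τ * (D * q) / 2 = D * (q ^ 2 / τ) / 2 by ring, hsq]; field_simp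
      rw [e2, e3] at hvel
      have h1 := norm_fst_le (u τ y)
      rw [Real.norm_eq_abs] at h1
      have h2 := drift_bound hM0 hS0 hC0 (by linarith : 4 + 2 * M + 16 * S + 2 * C ≤ D) hτ.1.le hexp
      linarith [neg_abs_le (u τ y).1]
    · intro y hy
      rw [(hρq 2 self_mem_Ici).1]
      simp only [neg_apply, ContinuousLinearMap.coe_fst']
      have h1 := (norm_fst_le y).trans (hK' y hy)
      rw [Real.norm_eq_abs] at h1
      have h2 : 1 ≤ Real.sqrt (2 * Real.log 2) := by
        rw [Real.one_le_sqrt]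
        linarith [Real.log_two_gt_d9]
      nlinarith [neg_abs_le y.1, le_max_left K' 0]
  intro x hx
  refine ⟨hsol.suppIn t hx, ?_⟩
  exact closure_minimal (t := {x : ℝ × ℝ | -(D * Real.sqrt (t * Real.log t)) ≤ x.1}) hbarrier
    (isClosed_le continuous_const continuous_fst) hx
end
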